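/- Let S be a cap of size 112 in F = (Fin 6 → ZMod 3). For every pair (ℓ₁, ℓ₂) of linearly independent linear functionals on F, the multiset of the nine cardinalities |S ∩ ℓ₁⁻¹(a) ∩ ℓ₂⁻¹(b)| for (a, b) ∈ (ZMod 3)² is one of: (i) {18, 18, 18, 18, 9, 9, 9, 9, 4}, (ii) {15, 15, 15, 15, 15, 15, 10, 6, 6}, or (iii) {16, 12, 12, 12, 12, 12, 12, 12, 12}. Moreover, among the two-dimensional subspaces of the dual space of F (which correspond to 4-flat directions and whose total number is 11011), exactly 1540 yield case (i), exactly 3696 yield case (ii), and exactly 5775 yield case (iii). -/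

import Mathlib

/-- A cap in the `n`-dimensional affine space over the field of three elements. -/
def IsCap {n : ℕ} (S : Finset (Fin n → ZMod 3)) : Prop :=
  ∀ a ∈ S, ∀ b ∈ S, ∀ c ∈ S, a ≠ b → a ≠ c → b ≠ c → a + b + c ≠ 0

/-- The multiset of the nine cardinalities `|S ∩ ℓ₁⁻¹(a) ∩ ℓ₂⁻¹(b)|`
for `(a, b) ∈ (ZMod 3)²`. -/
def nineMul {n : ℕ} (S : Finset (Fin n → ZMod 3))
    (ℓ₁ ℓ₂ : (Fin n → ZMod 3) →ₗ[ZMod 3] ZMod 3) : Multiset ℕ :=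
  (Finset.univ : Finset (ZMod 3 × ZMod 3)).val.map
    fun p => (S.filter fun x => ℓ₁ x = p.1 ∧ ℓ₂ x = p.2).card

namespace TernaryCap

open Module

/-- The number of points of `S` on which the functional `ξ` takes the value `t`. -/
def lv {V : Type*} [AddCommGroup V] [Module (ZMod 3) V] (S : Finset V) (ξ : Dual (ZMod 3) V)
    (t : ZMod 3) : ℕ := (S.filter fun x => ξ x = t).card

/-- The sum of the squares of three numbers. -/
def sq3 (x y z : ℕ) : ℕ := x * x + y * y + z * z

/-- The number of triples with prescribed zero sum of labels, when `x`, `y`, `z` points carry the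
labels `0`, `1`, `2` of `ZMod 3`. -/
def cub3 (x y z : ℕ) : ℕ := x * x * x + y * y * y + z * z * z + 6 * x * y * z

/-- A set in which only constant triples sum to zero. -/
def CapSet {V : Type*} [AddCommGroup V] (S : Finset V) : Prop :=
  ∀ a ∈ S, ∀ b ∈ S, ∀ c ∈ S, a + b + c = 0 → a = b

section
variable {V : Type*} [AddCommGroup V] [Module (ZMod 3) V]

theorem sum_zmod3 {M : Type*} [AddCommMonoid M] (f : ZMod 3 → M) :
    ∑ t, f t = f 0 + f 1 + f 2 := Fin.sum_univ_three f

theorem lv_sum (S : Finset V) (ξ : Dual (ZMod 3) V) (t : ZMod 3) :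
    lv S ξ t = ∑ x ∈ S, if ξ x = t then 1 else 0 := by
  simp [lv]

theorem lv_total (S : Finset V) (ξ : Dual (ZMod 3) V) (t : ZMod 3) :
    lv S ξ t + lv S ξ (t + 1) + lv S ξ (t + 2) = S.card := by
  have h : S.card = ∑ s, lv S ξ s :=
    Finset.card_eq_sum_card_fiberwise (fun x _ => Finset.mem_univ (ξ x))
  rw [h, sum_zmod3]
  obtain rfl | rfl | rfl : t = 0 ∨ t = 1 ∨ t = 2 := by revert t; decide
  · rfl
  · show lv S ξ 1 + lv S ξ 2 + lv S ξ 0 = _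
    omega
  · show lv S ξ 2 + lv S ξ 0 + lv S ξ 1 = _
    omega

/-- The pairs of points of `A` not separated by `η`. -/
theorem card_pairs (A : Finset V) (η : Dual (ZMod 3) V) :
    ((A ×ˢ A).filter fun p => η (p.1 - p.2) = 0).card =
      sq3 (lv A η 0) (lv A η 1) (lv A η 2) := by
  have key : ∀ u v : ZMod 3, (if u - v = 0 then 1 else 0) =
      ∑ t, (if u = t then 1 else 0) * (if v = t then 1 else 0) := by decide
  have : sq3 (lv A η 0) (lv A η 1) (lv A η 2) = ∑ t, lv A η t * lv A η t := by
    rw [sum_zmod3]; rfl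
  rw [this, Finset.card_filter, Finset.sum_product]
  simp only [map_sub, key, lv_sum, Finset.sum_mul_sum]
  rw [Finset.sum_comm]
  conv_rhs => rw [Finset.sum_comm]
  rw [Finset.sum_comm]
  refine Finset.sum_congr rfl fun x _ => ?_
  rw [Finset.sum_comm]

theorem card_triples (A B C : Finset V) (η : Dual (ZMod 3) V) :
    ((A ×ˢ B ×ˢ C).filter fun p => η (p.1 + p.2.1 + p.2.2) = 0).card =
      ∑ i, ∑ j, lv A η i * lv B η j * lv C η (-i - j) := by
  rw [Finset.card_eq_sum_card_fiberwise (f := fun p => (η p.1, η p.2.1)) (t := Finset.univ)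
    (fun _ _ => Finset.mem_univ _), Fintype.sum_prod_type]
  refine Finset.sum_congr rfl fun i _ => Finset.sum_congr rfl fun j _ => ?_
  rw [mul_assoc]
  simp only [lv, ← Finset.card_product]
  congr 1
  ext ⟨x, y, z⟩
  simp only [Finset.mem_filter, Finset.mem_product, map_add, Prod.mk.injEq]
  constructor
  · rintro ⟨⟨⟨hx, hy, hz⟩, h⟩, rfl, rfl⟩
    exact ⟨⟨hx, rfl⟩, ⟨hy, rfl⟩, hz, by linear_combination h⟩
  · rintro ⟨⟨hx, rfl⟩, ⟨hy, rfl⟩, hz, h⟩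
    exact ⟨⟨⟨hx, hy, hz⟩, by rw [h]; ring⟩, rfl, rfl⟩

theorem card_triples_self (A : Finset V) (η : Dual (ZMod 3) V) :
    ((A ×ˢ A ×ˢ A).filter fun p => η (p.1 + p.2.1 + p.2.2) = 0).card =
      cub3 (lv A η 0) (lv A η 1) (lv A η 2) := by
  rw [card_triples]
  simp only [sum_zmod3]
  rw [show (-0 - 0 : ZMod 3) = 0 by decide, show (-0 - 1 : ZMod 3) = 2 by decide,
    show (-0 - 2 : ZMod 3) = 1 by decide, show (-1 - 0 : ZMod 3) = 2 by decide,
    show (-1 - 1 : ZMod 3) = 1 by decide, show (-1 - 2 : ZMod 3) = 0 by decide,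
    show (-2 - 0 : ZMod 3) = 1 by decide, show (-2 - 1 : ZMod 3) = 0 by decide,
    show (-2 - 2 : ZMod 3) = 2 by decide]
  unfold cub3; ring

/-- The number of triples with zero sum of labels, when three sets have `a i`, `b i`, `c i` points
of label `i`. -/
def lineSum (a0 a1 a2 b0 b1 b2 c0 c1 c2 : ℕ) : ℕ :=
  c0 * (a0 * b0 + a1 * b2 + a2 * b1) + c1 * (a0 * b2 + a1 * b1 + a2 * b0) +
    c2 * (a0 * b1 + a1 * b0 + a2 * b2)

theorem card_triples_lines (A B C : Finset V) (η : Dual (ZMod 3) V) :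
    ((A ×ˢ B ×ˢ C).filter fun p => η (p.1 + p.2.1 + p.2.2) = 0).card =
      lineSum (lv A η 0) (lv A η 1) (lv A η 2) (lv B η 0) (lv B η 1) (lv B η 2)
        (lv C η 0) (lv C η 1) (lv C η 2) := by
  rw [card_triples]
  simp only [sum_zmod3]
  rw [show (-0 - 0 : ZMod 3) = 0 by decide, show (-0 - 1 : ZMod 3) = 2 by decide,
    show (-0 - 2 : ZMod 3) = 1 by decide, show (-1 - 0 : ZMod 3) = 2 by decide,
    show (-1 - 1 : ZMod 3) = 1 by decide, show (-1 - 2 : ZMod 3) = 0 by decide,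
    show (-2 - 0 : ZMod 3) = 1 by decide, show (-2 - 1 : ZMod 3) = 0 by decide,
    show (-2 - 2 : ZMod 3) = 2 by decide]
  unfold lineSum; ring

theorem card_dual {d : ℕ} [Finite V] [Fintype (Dual (ZMod 3) V)] (hd : finrank (ZMod 3) V = d) :
    Fintype.card (Dual (ZMod 3) V) = 3 ^ d := by
  rw [Module.card_eq_pow_finrank (K := ZMod 3), Subspace.dual_finrank_eq, hd]; simp

theorem card_annihilator [Fintype (Dual (ZMod 3) V)] {q : ℕ}
    (hq : Fintype.card (Dual (ZMod 3) V) = 3 * q) {v : V}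
    (hv : v ≠ 0) : (Finset.univ.filter fun η : Dual (ZMod 3) V => η v = 0).card = q := by
  obtain ⟨ζ, hζ⟩ : ∃ ζ : Dual (ZMod 3) V, ζ v = 1 :=
    Module.Projective.exists_dual_eq_one (ZMod 3) hv
  have h := Finset.card_eq_sum_card_fiberwise (s := (Finset.univ : Finset (Dual (ZMod 3) V)))
    (f := fun η => η v) (t := Finset.univ) (fun _ _ => Finset.mem_univ _)
  have e : ∀ t : ZMod 3, (Finset.univ.filter fun η : Dual (ZMod 3) V => η v = t).card =
      (Finset.univ.filter fun η : Dual (ZMod 3) V => η v = 0).card := by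
    intro t
    refine Finset.card_bij (fun η _ => η - t • ζ) ?_ ?_ ?_
    · intro η h; simp at h ⊢; simp [h, hζ]
    · intro a _ b _ h; simpa using h
    · intro b h; simp at h; exact ⟨b + t • ζ, by simp [h, hζ], by simp⟩
  rw [Finset.card_univ, hq] at h
  simp only [e] at h
  simp at h
  omega

theorem sum_card_vanish [Fintype (Dual (ZMod 3) V)] {q : ℕ}
    (hq : Fintype.card (Dual (ZMod 3) V) = 3 * q) {ι : Type*}
    (P : Finset ι) (f : ι → V) [DecidableEq V] :
    ∑ η : Dual (ZMod 3) V, (P.filter fun p => η (f p) = 0).card =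
      q * P.card + 2 * q * (P.filter fun p => f p = 0).card := by
  simp only [Finset.card_filter]
  rw [Finset.sum_comm]
  have : ∀ p ∈ P, (∑ η : Dual (ZMod 3) V, if η (f p) = 0 then 1 else 0) =
      q + 2 * q * if f p = 0 then 1 else 0 := by
    intro p _
    split_ifs with h
    · simp [h, hq]; ring
    · rw [← Finset.card_filter, card_annihilator hq h]; simp
  rw [Finset.sum_congr rfl this, Finset.sum_add_distrib, ← Finset.mul_sum]
  simp [mul_comm]

theorem sum_sq3 [Fintype (Dual (ZMod 3) V)] {q : ℕ}
    (hq : Fintype.card (Dual (ZMod 3) V) = 3 * q) (A : Finset V) :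
    ∑ η : Dual (ZMod 3) V, sq3 (lv A η 0) (lv A η 1) (lv A η 2) =
      q * (A.card * A.card) + 2 * q * A.card := by
  classical
  simp only [← card_pairs]
  rw [sum_card_vanish hq, Finset.card_product]
  congr 2
  refine Finset.card_bij (fun p _ => p.1) ?_ ?_ ?_
  · rintro ⟨x, y⟩ h; simp at h; simp [h]
  · rintro ⟨x, y⟩ h ⟨x', y'⟩ h' e
    simp [sub_eq_zero] at h h' e; simp [← h.2, ← h'.2, e]
  · intro x hx; exact ⟨(x, x), by simp [hx], rfl⟩

theorem add_self_add_self (x : V) : x + x + x = 0 := by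
  have h : (1 + 1 + 1 : ZMod 3) • x = x + x + x := by simp only [add_smul, one_smul]
  rw [← h, show (1 + 1 + 1 : ZMod 3) = 0 by decide, zero_smul]

theorem sum_cub3 [Fintype (Dual (ZMod 3) V)] {q : ℕ}
    (hq : Fintype.card (Dual (ZMod 3) V) = 3 * q) {A : Finset V}
    (hA : CapSet A) :
    ∑ η : Dual (ZMod 3) V, cub3 (lv A η 0) (lv A η 1) (lv A η 2) =
      q * (A.card * A.card * A.card) + 2 * q * A.card := by
  classical
  simp only [← card_triples_self]
  rw [sum_card_vanish hq, Finset.card_product, Finset.card_product, ← mul_assoc A.card]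
  congr 2
  refine Finset.card_bij (fun p _ => p.1) ?_ ?_ ?_
  · rintro ⟨x, y, z⟩ h; simp at h; simp [h]
  · rintro ⟨x, y, z⟩ h ⟨x', y', z'⟩ h' e
    simp only [Finset.mem_filter, Finset.mem_product] at h h' e
    obtain ⟨⟨hx, hy, hz⟩, h⟩ := h
    obtain ⟨⟨hx', hy', hz'⟩, h'⟩ := h'
    subst e
    have e1 := hA _ hx _ hy _ hz h
    have e2 := hA _ hx' _ hy' _ hz' h'
    subst e1 e2
    simpa using add_left_cancel (h.trans h'.symm)
  · intro x hx; exact ⟨(x, x, x), by simp [hx, add_self_add_self], rfl⟩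

theorem sum_lineSum [Fintype (Dual (ZMod 3) V)] {q : ℕ}
    (hq : Fintype.card (Dual (ZMod 3) V) = 3 * q) {A B C : Finset V}
    (h0 : ∀ x ∈ A, ∀ y ∈ B, ∀ z ∈ C, x + y + z ≠ 0) :
    ∑ η : Dual (ZMod 3) V, lineSum (lv A η 0) (lv A η 1) (lv A η 2) (lv B η 0) (lv B η 1)
      (lv B η 2) (lv C η 0) (lv C η 1) (lv C η 2) = q * (A.card * B.card * C.card) := by
  classical
  simp only [← card_triples_lines]
  rw [sum_card_vanish hq, Finset.card_product, Finset.card_product, ← mul_assoc A.card,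
    Finset.filter_eq_empty_iff.2]
  · simp
  · rintro ⟨x, y, z⟩ h
    simp only [Finset.mem_product] at h
    exact h0 _ h.1 _ h.2.1 _ h.2.2

/-- Weights of a linear functional on the invariants of a `3 × 3` array of slice sizes. -/
structure Weights where
  p0 : ℕ
  pa : ℕ
  pb : ℕ
  pc : ℕ
  qa : ℕ
  qb : ℕ
  qc : ℕ
  l : ℕ

/-- The value of the weighted functional on a `3 × 3` array. -/
def Weights.eval (w : Weights) (a0 a1 a2 b0 b1 b2 c0 c1 c2 : ℕ) : ℕ :=
  w.p0 + w.pa * sq3 a0 a1 a2 + w.pb * sq3 b0 b1 b2 + w.pc * sq3 c0 c1 c2 +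
    w.qa * cub3 a0 a1 a2 + w.qb * cub3 b0 b1 b2 + w.qc * cub3 c0 c1 c2 +
    w.l * lineSum a0 a1 a2 b0 b1 b2 c0 c1 c2

/-- The value of the weighted functional on the array cut out of `A`, `B`, `C` by `η`. -/
def Weights.evalArr (w : Weights) (A B C : Finset V) (η : Dual (ZMod 3) V) : ℕ :=
  w.eval (lv A η 0) (lv A η 1) (lv A η 2) (lv B η 0) (lv B η 1) (lv B η 2)
        (lv C η 0) (lv C η 1) (lv C η 2)

/-- The total of the weighted functional over a dual space with `3 * q` elements. -/
def Weights.all (w : Weights) (q a b c : ℕ) : ℕ :=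
  w.p0 * (3 * q) + w.pa * (q * (a * a) + 2 * q * a) + w.pb * (q * (b * b) + 2 * q * b) +
    w.pc * (q * (c * c) + 2 * q * c) + w.qa * (q * (a * a * a) + 2 * q * a) +
    w.qb * (q * (b * b * b) + 2 * q * b) + w.qc * (q * (c * c * c) + 2 * q * c) +
    w.l * (q * (a * b * c))

/-- The value of the weighted functional on an array whose rows have one nonzero entry each. -/
def Weights.dep (w : Weights) (a b c : ℕ) : ℕ :=
  w.p0 + w.pa * (a * a) + w.pb * (b * b) + w.pc * (c * c) + w.qa * (a * a * a) +
    w.qb * (b * b * b) + w.qc * (c * c * c) + w.l * (a * b * c)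

theorem sum_evalArr [Fintype (Dual (ZMod 3) V)] {q : ℕ}
    (hq : Fintype.card (Dual (ZMod 3) V) = 3 * q) {A B C : Finset V}
    (hA : CapSet A) (hB : CapSet B) (hC : CapSet C)
    (h0 : ∀ x ∈ A, ∀ y ∈ B, ∀ z ∈ C, x + y + z ≠ 0) (w : Weights) :
    ∑ η : Dual (ZMod 3) V, w.evalArr A B C η = w.all q A.card B.card C.card := by
  simp only [Weights.evalArr, Weights.eval, Weights.all, Finset.sum_add_distrib, ← Finset.mul_sum,
    sum_sq3 hq, sum_cub3 hq hA, sum_cub3 hq hB, sum_cub3 hq hC, sum_lineSum hq h0]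
  simp [hq, mul_comm]

theorem sq3_const {A : Finset V} {η : Dual (ZMod 3) V} {u : ZMod 3} (h : ∀ x ∈ A, η x = u) :
    sq3 (lv A η 0) (lv A η 1) (lv A η 2) = A.card * A.card := by
  rw [← card_pairs, ← Finset.card_product, Finset.filter_true_of_mem]
  rintro ⟨x, y⟩ hp
  rw [Finset.mem_product] at hp
  simp [h _ hp.1, h _ hp.2]

theorem cub3_const {A : Finset V} {η : Dual (ZMod 3) V} {u : ZMod 3} (h : ∀ x ∈ A, η x = u) :
    cub3 (lv A η 0) (lv A η 1) (lv A η 2) = A.card * A.card * A.card := by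
  rw [← card_triples_self, mul_assoc, ← Finset.card_product, ← Finset.card_product,
    Finset.filter_true_of_mem]
  rintro ⟨x, y, z⟩ hp
  simp only [Finset.mem_product] at hp
  simp only [map_add, h _ hp.1, h _ hp.2.1, h _ hp.2.2]
  exact add_self_add_self u

theorem lineSum_const {A B C : Finset V} {η : Dual (ZMod 3) V} {u v w : ZMod 3}
    (hA : ∀ x ∈ A, η x = u) (hB : ∀ x ∈ B, η x = v) (hC : ∀ x ∈ C, η x = w)
    (h0 : u + v + w = 0) :
    lineSum (lv A η 0) (lv A η 1) (lv A η 2) (lv B η 0) (lv B η 1)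
      (lv B η 2) (lv C η 0) (lv C η 1) (lv C η 2) = A.card * B.card * C.card := by
  rw [← card_triples_lines, mul_assoc, ← Finset.card_product, ← Finset.card_product,
    Finset.filter_true_of_mem]
  rintro ⟨x, y, z⟩ hp
  simp only [Finset.mem_product] at hp
  simp only [map_add, hA _ hp.1, hB _ hp.2.1, hC _ hp.2.2, h0]

theorem evalArr_const {A B C : Finset V} {η : Dual (ZMod 3) V} {u v w : ZMod 3}
    (hA : ∀ x ∈ A, η x = u) (hB : ∀ x ∈ B, η x = v) (hC : ∀ x ∈ C, η x = w)
    (h0 : u + v + w = 0) (W : Weights) :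
    W.evalArr A B C η = W.dep A.card B.card C.card := by
  simp only [Weights.evalArr, Weights.eval, Weights.dep, sq3_const hA, sq3_const hB, sq3_const hC,
    cub3_const hA, cub3_const hB, cub3_const hC, lineSum_const hA hB hC h0]

/-- The points of `S` on which the functional `ξ` takes the value `t`. -/
def slice (S : Finset V) (ξ : Dual (ZMod 3) V) (t : ZMod 3) : Finset V := S.filter fun x => ξ x = t

theorem CapSet.subset {V : Type*} [AddCommGroup V] {S T : Finset V} (hS : CapSet S) (h : T ⊆ S) :
    CapSet T :=
  fun a ha b hb c hc => hS a (h ha) b (h hb) c (h hc)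

theorem slices_sum_ne_zero {S : Finset V} (hS : CapSet S) (ξ : Dual (ZMod 3) V) (t : ZMod 3) :
    ∀ x ∈ slice S ξ t, ∀ y ∈ slice S ξ (t + 1), ∀ z ∈ slice S ξ (t + 2), x + y + z ≠ 0 := by
  intro x hx y hy z hz h
  simp only [slice, Finset.mem_filter] at hx hy hz
  have := hS x hx.1 y hy.1 z hz.1 h
  subst this
  exact (show ∀ t : ZMod 3, t ≠ t + 1 by decide) t (hx.2.symm.trans hy.2)

/-- `η` is not a multiple of `ξ`. -/
def Indep (ξ η : Dual (ZMod 3) V) : Prop := ∀ β : ZMod 3, η ≠ β • ξ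

open Classical in
theorem sum_indep [Fintype (Dual (ZMod 3) V)] {q : ℕ}
    (hq : Fintype.card (Dual (ZMod 3) V) = 3 * q) {S : Finset V}
    (hS : CapSet S) {ξ : Dual (ZMod 3) V} (hξ : ξ ≠ 0) (t : ZMod 3) (w : Weights) :
    (∑ η with Indep ξ η, w.evalArr (slice S ξ t) (slice S ξ (t + 1)) (slice S ξ (t + 2)) η) +
      3 * w.dep (lv S ξ t) (lv S ξ (t + 1)) (lv S ξ (t + 2)) =
    w.all q (lv S ξ t) (lv S ξ (t + 1)) (lv S ξ (t + 2)) := by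
  have hs : ∀ i, CapSet (slice S ξ i) := fun i => hS.subset (Finset.filter_subset _ _)
  have e := sum_evalArr hq (hs t) (hs (t + 1)) (hs (t + 2)) (slices_sum_ne_zero hS ξ t) w
  rw [← Finset.sum_filter_add_sum_filter_not _ (fun η => Indep ξ η)] at e
  change _ = w.all q (slice S ξ t).card (slice S ξ (t + 1)).card (slice S ξ (t + 2)).card
  rw [← e]
  congr 1
  have : (Finset.univ.filter fun η => ¬ Indep ξ η) =
      (Finset.univ : Finset (ZMod 3)).image fun β => β • ξ := by
    ext η; simp [Indep, eq_comm]
  rw [this, Finset.sum_image]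
  · have h : ∀ β : ZMod 3, w.evalArr (slice S ξ t) (slice S ξ (t + 1)) (slice S ξ (t + 2))
        (β • ξ) = w.dep (lv S ξ t) (lv S ξ (t + 1)) (lv S ξ (t + 2)) := by
      intro β
      refine evalArr_const (u := β * t) (v := β * (t + 1)) (w := β * (t + 2)) ?_ ?_ ?_ ?_ w
      · intro x hx; simp only [slice, Finset.mem_filter] at hx; simp [hx.2]
      · intro x hx; simp only [slice, Finset.mem_filter] at hx; simp [hx.2]
      · intro x hx; simp only [slice, Finset.mem_filter] at hx; simp [hx.2]
      · exact (show ∀ β t : ZMod 3, β * t + β * (t + 1) + β * (t + 2) = 0 by decide) β t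
    simp [h]
  · intro a _ b _ h
    exact smul_left_injective _ hξ h

/-- Summation over all nonzero directions. -/
theorem sum_ne_zero [Fintype (Dual (ZMod 3) V)] {q : ℕ}
    (hq : Fintype.card (Dual (ZMod 3) V) = 3 * q) {S : Finset V}
    (hS : CapSet S) [DecidableEq (Dual (ZMod 3) V)] (l0 l2 l3 : ℤ) :
    ∑ η : Dual (ZMod 3) V with η ≠ 0, (l0 + l2 * (sq3 (lv S η 0) (lv S η 1) (lv S η 2) : ℤ) +
      l3 * (cub3 (lv S η 0) (lv S η 1) (lv S η 2) : ℤ)) =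
    l0 * (3 * q - 1) + l2 * (q * S.card ^ 2 + 2 * q * S.card - S.card ^ 2) +
      l3 * (q * S.card ^ 3 + 2 * q * S.card - S.card ^ 3) := by
  have e2 := congrArg (Nat.cast : ℕ → ℤ) (sum_sq3 hq S)
  have e3 := congrArg (Nat.cast : ℕ → ℤ) (sum_cub3 hq hS)
  push_cast at e2 e3
  have z2 := sq3_const (A := S) (η := (0 : Dual (ZMod 3) V)) (u := 0) (by simp)
  have z3 := cub3_const (A := S) (η := (0 : Dual (ZMod 3) V)) (u := 0) (by simp)
  rw [Finset.filter_ne', Finset.sum_erase_eq_sub (Finset.mem_univ _), z2, z3]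
  simp only [Finset.sum_add_distrib, ← Finset.mul_sum, e2, e3]
  simp [hq]
  ring

end

section
variable {V : Type*} [AddCommGroup V] [Module (ZMod 3) V]

/-- Every cap in a `d`-dimensional space has at most `N` points. -/
def CapBound (d N : ℕ) : Prop :=
  ∀ (V : Type) [AddCommGroup V] [Module (ZMod 3) V] [Finite V], finrank (ZMod 3) V = d →
    ∀ S : Finset V, CapSet S → S.card ≤ N

/-- In a `d`-dimensional space, the three parallel hyperplane sections of a cap satisfy `P`. -/
def CapAdm (d : ℕ) (P : ℕ → ℕ → ℕ → Prop) : Prop :=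
  ∀ (V : Type) [AddCommGroup V] [Module (ZMod 3) V] [Finite V], finrank (ZMod 3) V = d →
    ∀ S : Finset V, CapSet S → ∀ ξ : Dual (ZMod 3) V, ξ ≠ 0 → ∀ t,
      P (lv S ξ t) (lv S ξ (t + 1)) (lv S ξ (t + 2))

theorem exists_section {S : Finset V} (hS : CapSet S) {ξ : Dual (ZMod 3) V} (hξ : ξ ≠ 0)
    (t : ZMod 3) : ∃ T : Finset (LinearMap.ker ξ), CapSet T ∧ T.card = lv S ξ t ∧
      ∀ η : Dual (ZMod 3) V, ∃ r, ∀ s,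
        lv T (η ∘ₗ (LinearMap.ker ξ).subtype) s = lv (slice S ξ t) η (s + r) := by
  obtain ⟨v, hv⟩ : ∃ v, ξ v = 1 := by
    obtain ⟨w, hw⟩ : ∃ w, ξ w ≠ 0 := by
      by_contra! h
      exact hξ (LinearMap.ext h)
    exact ⟨(ξ w)⁻¹ • w, by simp [hw]⟩
  have inj : Function.Injective fun y : LinearMap.ker ξ => (y : V) + t • v := fun a b h =>
    Subtype.ext (add_right_cancel h)
  refine ⟨S.preimage (fun y : LinearMap.ker ξ => (y : V) + t • v) inj.injOn, ?_, ?_, ?_⟩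
  · intro a ha b hb c hc h
    rw [Finset.mem_preimage] at ha hb hc
    refine inj (hS _ ha _ hb _ hc ?_)
    have h' : (a : V) + b + c = 0 := by exact_mod_cast congrArg Subtype.val h
    calc (a : V) + t • v + (b + t • v) + (c + t • v)
        = (a + b + c) + (t • v + t • v + t • v) := by abel
      _ = 0 := by rw [h', add_self_add_self, add_zero]
  · refine Finset.card_bij (fun y _ => (y : V) + t • v) ?_ (fun a _ b _ h => inj h) ?_
    · intro y hy
      rw [Finset.mem_preimage] at hy
      simp [hy, hv]
    · intro x hx
      rw [Finset.mem_filter] at hx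
      exact ⟨⟨x - t • v, by simp [hx.2, hv]⟩, by simp [hx.1], by simp⟩
  · intro η
    refine ⟨t * η v, fun s => ?_⟩
    refine Finset.card_bij (fun y _ => (y : V) + t • v) ?_ (fun a _ b _ h => inj h) ?_
    · intro y hy
      simp only [Finset.mem_filter, Finset.mem_preimage] at hy
      simp [slice, hy.1, hv, ← hy.2]
    · intro x hx
      simp only [slice, Finset.mem_filter] at hx
      refine ⟨⟨x - t • v, by simp [hx.1.2, hv]⟩, ?_, by simp⟩
      rw [Finset.mem_filter, Finset.mem_preimage]
      exact ⟨by simpa using hx.1.1, by simp [hx.2]⟩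

theorem comp_ker_subtype_ne_zero {ξ η : Dual (ZMod 3) V} (hξ : ξ ≠ 0) (h : Indep ξ η) :
    η ∘ₗ (LinearMap.ker ξ).subtype ≠ 0 := by
  obtain ⟨w, hw⟩ : ∃ w, ξ w ≠ 0 := by
    by_contra! h
    exact hξ (LinearMap.ext h)
  intro h0
  refine h (η w * (ξ w)⁻¹) (LinearMap.ext fun x => ?_)
  have : η (x - (ξ x * (ξ w)⁻¹) • w) = 0 := by
    have hx : x - (ξ x * (ξ w)⁻¹) • w ∈ LinearMap.ker ξ := by simp [hw]
    exact LinearMap.congr_fun h0 ⟨_, hx⟩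
  simp only [map_sub, map_smul, smul_eq_mul, sub_eq_zero] at this
  simp only [LinearMap.smul_apply, smul_eq_mul, this]
  ring

theorem lv_le_of_bound {V : Type} [AddCommGroup V] [Module (ZMod 3) V] [Finite V] {d N : ℕ}
    (h : CapBound d N) (hd : finrank (ZMod 3) V = d + 1) {S : Finset V} (hS : CapSet S)
    {ξ : Dual (ZMod 3) V} (hξ : ξ ≠ 0) (t : ZMod 3) : lv S ξ t ≤ N := by
  obtain ⟨T, hT, hc, -⟩ := exists_section hS hξ t
  rw [← hc]
  have := Module.Dual.finrank_ker_add_one_of_ne_zero hξ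
  exact h _ (by omega) T hT

theorem adm_slice {V : Type} [AddCommGroup V] [Module (ZMod 3) V] [Finite V] {d : ℕ}
    {P : ℕ → ℕ → ℕ → Prop} (h : CapAdm d P) (hd : finrank (ZMod 3) V = d + 1) {S : Finset V}
    (hS : CapSet S) {ξ η : Dual (ZMod 3) V} (hξ : ξ ≠ 0) (hη : Indep ξ η) (i t : ZMod 3) :
    P (lv (slice S ξ i) η t) (lv (slice S ξ i) η (t + 1)) (lv (slice S ξ i) η (t + 2)) := by
  obtain ⟨T, hT, -, hl⟩ := exists_section hS hξ i
  obtain ⟨r, hr⟩ := hl η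
  have := Module.Dual.finrank_ker_add_one_of_ne_zero hξ
  have := h _ (by omega) T hT _ (comp_ker_subtype_ne_zero hξ hη) (t - r)
  rwa [hr, hr, hr, sub_add_cancel, show t - r + 1 + r = t + 1 by ring,
    show t - r + 2 + r = t + 2 by ring] at this

theorem Indep.ne_zero {ξ η : Dual (ZMod 3) V} (h : Indep ξ η) : η ≠ 0 := by
  simpa using h 0

theorem Indep.sub_smul {ξ η : Dual (ZMod 3) V} (hξ : ξ ≠ 0) (h : Indep ξ η) (β : ZMod 3) :
    Indep (η - β • ξ) ξ := by
  intro γ e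
  by_cases hγ : γ = 0
  · exact hξ (by simpa [hγ] using e)
  · refine h (γ⁻¹ + β) ?_
    have : γ⁻¹ • ξ = η - β • ξ := by
      rw [e, smul_smul, inv_mul_cancel₀ hγ, one_smul, ← e]
    rw [_root_.add_smul, this, sub_add_cancel]

theorem Indep.add_smul {ξ η : Dual (ZMod 3) V} (h : Indep ξ η) (β : ZMod 3) :
    Indep ξ (η + β • ξ) := by
  intro γ e
  refine h (γ - β) (LinearMap.ext fun x => ?_)
  have := LinearMap.congr_fun e x
  simp only [LinearMap.add_apply, LinearMap.smul_apply, smul_eq_mul] at this ⊢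
  linear_combination this

theorem lv_slice_comm (S : Finset V) (ξ η : Dual (ZMod 3) V) (β i t : ZMod 3) :
    lv (slice S (η - β • ξ) i) ξ t = lv (slice S ξ t) η (i + β * t) := by
  unfold lv slice
  rw [Finset.filter_filter, Finset.filter_filter]
  congr 1
  refine Finset.filter_congr fun x _ => ?_
  simp only [LinearMap.sub_apply, LinearMap.smul_apply, smul_eq_mul]
  constructor
  · rintro ⟨h, rfl⟩
    exact ⟨rfl, by rw [← h]; ring⟩
  · rintro ⟨rfl, h⟩
    exact ⟨by rw [h]; ring, rfl⟩

theorem lv_add_smul (S : Finset V) (ξ η : Dual (ZMod 3) V) (s t u : ZMod 3) :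
    lv S (η + s • ξ) u = lv (slice S ξ t) η (u - s * t) + lv (slice S ξ (t + 1)) η (u - s * (t + 1))
      + lv (slice S ξ (t + 2)) η (u - s * (t + 2)) := by
  have h := lv_total (S.filter fun x => (η + s • ξ) x = u) ξ t
  change _ = lv S (η + s • ξ) u at h
  rw [← h]
  have : ∀ i, lv (S.filter fun x => (η + s • ξ) x = u) ξ i =
      lv (slice S ξ i) η (u - s * i) := by
    intro i
    unfold lv slice
    rw [Finset.filter_filter, Finset.filter_filter]
    congr 1
    refine Finset.filter_congr fun x _ => ?_
    simp only [LinearMap.add_apply, LinearMap.smul_apply, smul_eq_mul]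
    constructor
    · rintro ⟨h, rfl⟩
      exact ⟨rfl, by rw [← h]; ring⟩
    · rintro ⟨rfl, h⟩
      exact ⟨by rw [h]; ring, rfl⟩
  simp only [this]

end

/-- Whether `f` holds at all numbers below `n`, in a form that reduces well in the kernel. -/
def allBelow (f : ℕ → Bool) (n : ℕ) : Bool := Nat.rec true (fun k ih => f k && ih) n

/-- Application of `f` to `n`, forcing the evaluation of `n` in the kernel. -/
def withNat (n : ℕ) (f : ℕ → Bool) : Bool := Nat.rec (f 0) (fun k _ => f (Nat.succ k)) n

/-- Lazy implication of Booleans. -/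
def bimp (b x : Bool) : Bool := Bool.rec true x b

/-- Lazy disjunction of Booleans. -/
def bor (b x : Bool) : Bool := Bool.rec x true b

theorem allBelow_spec {f : ℕ → Bool} {n : ℕ} (h : allBelow f n = true) {k : ℕ} (hk : k < n) :
    f k = true := by
  induction n with
  | zero => omega
  | succ n ih =>
    have h' : (f n && allBelow f n) = true := h
    rw [Bool.and_eq_true] at h'
    rcases Nat.lt_succ_iff_lt_or_eq.1 hk with hk | rfl
    · exact ih h'.2 hk
    · exact h'.1

@[simp]
theorem withNat_eq (n : ℕ) (f : ℕ → Bool) : withNat n f = f n := by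
  cases n <;> rfl

theorem bimp_spec {b x : Bool} (h : bimp b x = true) (hb : b = true) : x = true := by
  subst hb; exact h

theorem bor_spec {b x : Bool} (h : bor b x = true) : b = true ∨ x = true := by
  cases b
  · exact Or.inr h
  · exact Or.inl rfl

/-- Whether `f` holds at all triples of sum `n` whose first entry is maximal. -/
def rowLoop (n : ℕ) (f : ℕ → ℕ → ℕ → Bool) : Bool :=
  allBelow (fun x => bimp (Nat.ble n (3 * x)) (allBelow (fun y => bimp (Nat.ble n (2 * x + y))
    (withNat (n - x - y) fun z => f x y z)) (min x (n - x) + 1))) (n + 1)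

theorem rowLoop_spec {f : ℕ → ℕ → ℕ → Bool} {n : ℕ} (h : rowLoop n f = true) {x y z : ℕ}
    (hn : x + y + z = n) (hy : y ≤ x) (hz : z ≤ x) : f x y z = true := by
  have h1 := bimp_spec (allBelow_spec h (k := x) (by omega)) (Nat.ble_eq_true_of_le (by omega))
  have h2 := bimp_spec (allBelow_spec h1 (k := y) (by omega)) (Nat.ble_eq_true_of_le (by omega))
  rwa [withNat_eq, show n - x - y = z by omega] at h2

/-- The part of the weighted functional that depends on the first two rows only. -/
def Weights.evalRows (w : Weights) (a0 a1 a2 b0 b1 b2 : ℕ) : ℕ :=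
  w.p0 + w.pa * sq3 a0 a1 a2 + w.pb * sq3 b0 b1 b2 + w.qa * cub3 a0 a1 a2 + w.qb * cub3 b0 b1 b2

/-- The weighted functional, given its part `r` from the first two rows and their line counts. -/
def Weights.evalRest (w : Weights) (r k0 k1 k2 c0 c1 c2 : ℕ) : ℕ :=
  r + w.pc * sq3 c0 c1 c2 + w.qc * cub3 c0 c1 c2 + w.l * (c0 * k0 + c1 * k1 + c2 * k2)

theorem Weights.evalRest_evalRows (w : Weights) (a0 a1 a2 b0 b1 b2 c0 c1 c2 : ℕ) :
    w.evalRest (w.evalRows a0 a1 a2 b0 b1 b2) (a0 * b0 + a1 * b2 + a2 * b1)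
      (a0 * b2 + a1 * b1 + a2 * b0) (a0 * b1 + a1 * b0 + a2 * b2) c0 c1 c2 =
    w.eval a0 a1 a2 b0 b1 b2 c0 c1 c2 := by
  unfold evalRest evalRows eval lineSum; ring

/-- The size condition on a triple of parallel sections. -/
def Adm (k N : ℕ) (E : ℕ → ℕ → Bool) (x y z : ℕ) : Prop :=
  x ≤ k ∧ y ≤ k ∧ z ≤ k ∧ x + y + z ≤ N ∧ E (x + y + z) (sq3 x y z) = true

/-- The largest entry `c ≤ k` that keeps the sums `x + c`, `y + c`, `z + c` at most `N`. -/
def capUpTo (k N x y z : ℕ) : ℕ := min k (N - max x (max y z))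

/-- The verification at one array, where the two functionals take the values `vp` and `vn`. -/
def leafCheck (E : ℕ → ℕ → Bool) (T : ℕ → Bool) (R : ℕ → ℕ → ℕ → ℕ → Bool)
    (a0 a1 a2 b0 b1 b2 c0 c1 c2 : ℕ) (vp vn : ℕ) : Bool :=
  bimp (E (a0 + b2 + c1) (sq3 a0 b2 c1)) <| bimp (E (a1 + b1 + c1) (sq3 a1 b1 c1)) <|
  bimp (E (a2 + b0 + c1) (sq3 a2 b0 c1)) <| bimp (E (a0 + b1 + c2) (sq3 a0 b1 c2)) <|
  bimp (E (a1 + b0 + c2) (sq3 a1 b0 c2)) <| bimp (E (a2 + b2 + c2) (sq3 a2 b2 c2)) <|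
  bimp (T (sq3 (a0 + b0 + c0) (a1 + b1 + c1) (a2 + b2 + c2))) <|
  bimp (T (sq3 (a0 + b1 + c2) (a1 + b2 + c0) (a2 + b0 + c1))) <|
  bimp (T (sq3 (a0 + b2 + c1) (a1 + b0 + c2) (a2 + b1 + c0))) <|
  bor (Nat.ble (vn + 1) vp) (Nat.beq vn vp &&
    R (sq3 a0 a1 a2) (sq3 (a0 + b0 + c0) (a1 + b1 + c1) (a2 + b2 + c2))
      (sq3 (a0 + b1 + c2) (a1 + b2 + c0) (a2 + b0 + c1))
      (sq3 (a0 + b2 + c1) (a1 + b0 + c2) (a2 + b1 + c0)))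

/-- Exhaustive verification, over all arrays of slice sizes with row sums `a`, `b`, `c` (with first
column maximal in the first two rows), that the functional `p - n` is nonnegative, and that `R`
holds whenever it vanishes. -/
def arrayCheck (k N : ℕ) (E : ℕ → ℕ → Bool) (T : ℕ → Bool) (R : ℕ → ℕ → ℕ → ℕ → Bool)
    (p n : Weights) (a b c : ℕ) : Bool :=
  rowLoop a fun a0 a1 a2 => bimp (Nat.ble a0 k) <| bimp (E a (sq3 a0 a1 a2)) <|
  rowLoop b fun b0 b1 b2 => bimp (Nat.ble b0 k) <| bimp (E b (sq3 b0 b1 b2)) <|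
  withNat (capUpTo k N (a0 + b0) (a1 + b2) (a2 + b1)) fun u0 =>
  withNat (capUpTo k N (a0 + b2) (a1 + b1) (a2 + b0)) fun u1 =>
  withNat (capUpTo k N (a0 + b1) (a1 + b0) (a2 + b2)) fun u2 =>
  bimp (Nat.ble c (u0 + u1 + u2)) <|
  withNat (a0 * b0 + a1 * b2 + a2 * b1) fun k0 =>
  withNat (a0 * b2 + a1 * b1 + a2 * b0) fun k1 =>
  withNat (a0 * b1 + a1 * b0 + a2 * b2) fun k2 =>
  withNat (p.evalRows a0 a1 a2 b0 b1 b2) fun rp =>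
  withNat (n.evalRows a0 a1 a2 b0 b1 b2) fun rn =>
  allBelow (fun c0 => bimp (Nat.ble c (c0 + u1 + u2)) <|
    bimp (E (a0 + b0 + c0) (sq3 a0 b0 c0)) <| bimp (E (a1 + b2 + c0) (sq3 a1 b2 c0)) <|
    bimp (E (a2 + b1 + c0) (sq3 a2 b1 c0)) <|
    allBelow (fun c1 => bimp (Nat.ble c (c0 + c1 + u2)) <| withNat (c - c0 - c1) fun c2 =>
      leafCheck E T R a0 a1 a2 b0 b1 b2 c0 c1 c2 (p.evalRest rp k0 k1 k2 c0 c1 c2)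
        (n.evalRest rn k0 k1 k2 c0 c1 c2)) (min u1 (c - c0) + 1)) (min u0 c + 1)

theorem le_capUpTo {k N x y z c : ℕ} (hk : c ≤ k) (hx : x + c ≤ N) (hy : y + c ≤ N)
    (hz : z + c ≤ N) : c ≤ capUpTo k N x y z := by
  unfold capUpTo; omega

/-- The sum of squares of the line sums of slope `s`. -/
def shearCode (m : ZMod 3 → ZMod 3 → ℕ) (s : ZMod 3) : ℕ :=
  sq3 (m 0 0 + m 1 s + m 2 (s * 2)) (m 0 1 + m 1 (1 + s) + m 2 (1 + s * 2))
    (m 0 2 + m 1 (2 + s) + m 2 (2 + s * 2))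

/-- Arrays of slice sizes: the nine-fold refinement of a triple of parallel hyperplane sections. -/
structure IsArray (P : ℕ → ℕ → ℕ → Prop) (T : ℕ → Bool) (m : ZMod 3 → ZMod 3 → ℕ) : Prop where
  row : ∀ i j, P (m i j) (m i (j + 1)) (m i (j + 2))
  trans : ∀ j β, P (m 0 j) (m 1 (j + β)) (m 2 (j + β * 2))
  shear : ∀ s, T (shearCode m s) = true

/-- The value of the weighted functional on an array given as a function. -/
def Weights.evalArray (w : Weights) (m : ZMod 3 → ZMod 3 → ℕ) : ℕ :=
  w.eval (m 0 0) (m 0 1) (m 0 2) (m 1 0) (m 1 1) (m 1 2) (m 2 0) (m 2 1) (m 2 2)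

theorem arrayCheck_spec_of_max {k N : ℕ} {E : ℕ → ℕ → Bool} {T : ℕ → Bool}
    {R : ℕ → ℕ → ℕ → ℕ → Bool} {p n : Weights} {a b c : ℕ}
    (h : arrayCheck k N E T R p n a b c = true) {m : ZMod 3 → ZMod 3 → ℕ}
    (hm : IsArray (Adm k N E) T m) (ha : m 0 0 + m 0 1 + m 0 2 = a)
    (hb : m 1 0 + m 1 1 + m 1 2 = b) (hc : m 2 0 + m 2 1 + m 2 2 = c)
    (ha1 : m 0 1 ≤ m 0 0) (ha2 : m 0 2 ≤ m 0 0) (hb1 : m 1 1 ≤ m 1 0) (hb2 : m 1 2 ≤ m 1 0) :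
    n.evalArray m ≤ p.evalArray m ∧ (n.evalArray m = p.evalArray m →
      R (sq3 (m 0 0) (m 0 1) (m 0 2)) (shearCode m 0) (shearCode m 1) (shearCode m 2) = true) := by
  obtain ⟨hA, -, -, -, eA⟩ : Adm k N E (m 0 0) (m 0 1) (m 0 2) := hm.row 0 0
  obtain ⟨hB, -, -, -, eB⟩ : Adm k N E (m 1 0) (m 1 1) (m 1 2) := hm.row 1 0
  rw [ha] at eA
  rw [hb] at eB
  obtain ⟨hC0, hC1, hC2, -⟩ : Adm k N E (m 2 0) (m 2 1) (m 2 2) := hm.row 2 0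
  have t000 : Adm k N E (m 0 0) (m 1 0) (m 2 0) := hm.trans 0 0
  have t012 : Adm k N E (m 0 0) (m 1 1) (m 2 2) := hm.trans 0 1
  have t021 : Adm k N E (m 0 0) (m 1 2) (m 2 1) := hm.trans 0 2
  have t111 : Adm k N E (m 0 1) (m 1 1) (m 2 1) := hm.trans 1 0
  have t120 : Adm k N E (m 0 1) (m 1 2) (m 2 0) := hm.trans 1 1
  have t102 : Adm k N E (m 0 1) (m 1 0) (m 2 2) := hm.trans 1 2
  have t222 : Adm k N E (m 0 2) (m 1 2) (m 2 2) := hm.trans 2 0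
  have t201 : Adm k N E (m 0 2) (m 1 0) (m 2 1) := hm.trans 2 1
  have t210 : Adm k N E (m 0 2) (m 1 1) (m 2 0) := hm.trans 2 2
  have s0 : T (sq3 (m 0 0 + m 1 0 + m 2 0) (m 0 1 + m 1 1 + m 2 1) (m 0 2 + m 1 2 + m 2 2)) =
    true := hm.shear 0
  have s1 : T (sq3 (m 0 0 + m 1 1 + m 2 2) (m 0 1 + m 1 2 + m 2 0) (m 0 2 + m 1 0 + m 2 1)) =
    true := hm.shear 1
  have s2 : T (sq3 (m 0 0 + m 1 2 + m 2 1) (m 0 1 + m 1 0 + m 2 2) (m 0 2 + m 1 1 + m 2 0)) =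
    true := hm.shear 2
  change _ ∧ (_ → R (sq3 (m 0 0) (m 0 1) (m 0 2))
    (sq3 (m 0 0 + m 1 0 + m 2 0) (m 0 1 + m 1 1 + m 2 1) (m 0 2 + m 1 2 + m 2 2))
    (sq3 (m 0 0 + m 1 1 + m 2 2) (m 0 1 + m 1 2 + m 2 0) (m 0 2 + m 1 0 + m 2 1))
    (sq3 (m 0 0 + m 1 2 + m 2 1) (m 0 1 + m 1 0 + m 2 2) (m 0 2 + m 1 1 + m 2 0)) = true)
  unfold Weights.evalArray
  generalize m 0 0 = a0, m 0 1 = a1, m 0 2 = a2, m 1 0 = b0, m 1 1 = b1, m 1 2 = b2,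
    m 2 0 = c0, m 2 1 = c1, m 2 2 = c2 at *
  have ble : ∀ {x y : ℕ}, x ≤ y → Nat.ble x y = true := Nat.ble_eq_true_of_le
  unfold Adm at *
  have u0 := le_capUpTo (k := k) (N := N) (x := a0 + b0) (y := a1 + b2) (z := a2 + b1) hC0
    (by omega) (by omega) (by omega)
  have u1 := le_capUpTo (k := k) (N := N) (x := a0 + b2) (y := a1 + b1) (z := a2 + b0) hC1
    (by omega) (by omega) (by omega)
  have u2 := le_capUpTo (k := k) (N := N) (x := a0 + b1) (y := a1 + b0) (z := a2 + b2) hC2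
    (by omega) (by omega) (by omega)
  have h1 := bimp_spec (bimp_spec (rowLoop_spec h ha ha1 ha2) (ble hA)) eA
  have h2 := bimp_spec (bimp_spec (rowLoop_spec h1 hb hb1 hb2) (ble hB)) eB
  simp only [withNat_eq, Weights.evalRest_evalRows] at h2
  have h3 := bimp_spec h2 (ble (by omega))
  have h4 := bimp_spec (allBelow_spec h3 (k := c0) (by omega)) (ble (by omega))
  have h5 := bimp_spec (bimp_spec (bimp_spec h4 t000.2.2.2.2) t120.2.2.2.2) t210.2.2.2.2
  have h6 := bimp_spec (allBelow_spec h5 (k := c1) (by omega)) (ble (by omega))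
  rw [show c - c0 - c1 = c2 by omega] at h6
  have h7 := bimp_spec (bimp_spec (bimp_spec h6 t021.2.2.2.2) t111.2.2.2.2) t201.2.2.2.2
  have h8 := bimp_spec (bimp_spec (bimp_spec h7 t012.2.2.2.2) t102.2.2.2.2) t222.2.2.2.2
  rcases bor_spec (bimp_spec (bimp_spec (bimp_spec h8 s0) s1) s2) with h9 | h9
  · have := Nat.le_of_ble_eq_true h9
    exact ⟨by omega, fun e => by omega⟩
  · rw [Bool.and_eq_true] at h9
    exact ⟨(Nat.eq_of_beq_eq_true h9.1).le, fun _ => h9.2⟩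

/-- Translate row `i` of an array by `α + β * i`. -/
def shearRotate (m : ZMod 3 → ZMod 3 → ℕ) (α β i j : ZMod 3) : ℕ := m i (j + (α + β * i))

theorem zmod3_cases (t : ZMod 3) : t = 0 ∨ t = 1 ∨ t = 2 := by
  revert t; decide

theorem sq3_shift (f : ZMod 3 → ℕ) (r : ZMod 3) :
    sq3 (f (0 + r)) (f (1 + r)) (f (2 + r)) = sq3 (f 0) (f 1) (f 2) := by
  obtain rfl | rfl | rfl := zmod3_cases r
  · simp
  · change sq3 (f 1) (f 2) (f 0) = _
    unfold sq3; ring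
  · change sq3 (f 2) (f 0) (f 1) = _
    unfold sq3; ring

theorem cub3_shift (f : ZMod 3 → ℕ) (r : ZMod 3) :
    cub3 (f (0 + r)) (f (1 + r)) (f (2 + r)) = cub3 (f 0) (f 1) (f 2) := by
  obtain rfl | rfl | rfl := zmod3_cases r
  · simp
  · change cub3 (f 1) (f 2) (f 0) = _
    unfold cub3; ring
  · change cub3 (f 2) (f 0) (f 1) = _
    unfold cub3; ring

theorem sum_shift (f : ZMod 3 → ℕ) (r : ZMod 3) :
    f (0 + r) + f (1 + r) + f (2 + r) = f 0 + f 1 + f 2 := by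
  obtain rfl | rfl | rfl := zmod3_cases r
  · simp
  · change f 1 + f 2 + f 0 = _
    ring
  · change f 2 + f 0 + f 1 = _
    ring

theorem lineSum_shift (f g h : ZMod 3 → ℕ) (r s : ZMod 3) :
    lineSum (f (0 + r)) (f (1 + r)) (f (2 + r)) (g (0 + s)) (g (1 + s)) (g (2 + s))
      (h (0 + -(r + s))) (h (1 + -(r + s))) (h (2 + -(r + s))) =
    lineSum (f 0) (f 1) (f 2) (g 0) (g 1) (g 2) (h 0) (h 1) (h 2) := by
  have e1 : (1 : ZMod 3) + 1 = 2 := by decide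
  have e2 : (1 : ZMod 3) + 2 = 0 := by decide
  have e3 : (2 : ZMod 3) + 1 = 0 := by decide
  have e4 : (2 : ZMod 3) + 2 = 1 := by decide
  have e5 : -(1 : ZMod 3) = 2 := by decide
  have e6 : -(2 : ZMod 3) = 1 := by decide
  obtain rfl | rfl | rfl := zmod3_cases r <;> obtain rfl | rfl | rfl := zmod3_cases s <;>
    simp only [e1, e2, e3, e4, e5, e6, zero_add, add_zero, neg_zero] <;> unfold lineSum <;> ring

theorem shearCode_rotate (m : ZMod 3 → ZMod 3 → ℕ) (α β s : ZMod 3) :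
    shearCode (shearRotate m α β) s = shearCode m (s + β) := by
  have h := sq3_shift (fun u => m 0 u + m 1 (u + (s + β)) + m 2 (u + (s + β) * 2)) α
  simp only [zero_add] at h
  unfold shearCode shearRotate
  rw [← h]
  ring_nf

theorem Weights.evalArray_rotate (w : Weights) (m : ZMod 3 → ZMod 3 → ℕ) (α β : ZMod 3) :
    w.evalArray (shearRotate m α β) = w.evalArray m := by
  have h2 : -((α + β * 0) + (α + β * 1)) = α + β * 2 := by
    revert α β; decide
  have h := lineSum_shift (m 0) (m 1) (m 2) (α + β * 0) (α + β * 1)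
  rw [h2] at h
  unfold evalArray eval shearRotate
  rw [h]
  simp only [sq3_shift, cub3_shift]

theorem IsArray.rotate {k N : ℕ} {E : ℕ → ℕ → Bool} {T : ℕ → Bool} {m : ZMod 3 → ZMod 3 → ℕ}
    (hm : IsArray (Adm k N E) T m) (α β : ZMod 3) :
    IsArray (Adm k N E) T (shearRotate m α β) where
  row i j := by
    have := hm.row i (j + (α + β * i))
    simpa only [shearRotate, add_right_comm] using this
  trans j γ := by
    have := hm.trans (j + α) (γ + β)
    unfold shearRotate
    convert this using 2 <;> ring
  shear s := by
    rw [shearCode_rotate]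
    exact hm.shear (s + β)

theorem exists_max_shift (f : ZMod 3 → ℕ) : ∃ r, f (1 + r) ≤ f (0 + r) ∧ f (2 + r) ≤ f (0 + r) := by
  obtain ⟨r, hr⟩ := Finite.exists_max f
  exact ⟨r, by simpa using hr _, by simpa using hr _⟩

/-- The conclusion of a successful `arrayCheck`, for all arrays. -/
theorem arrayCheck_spec {k N : ℕ} {E : ℕ → ℕ → Bool} {T : ℕ → Bool} {R : ℕ → ℕ → ℕ → ℕ → Bool}
    {p n : Weights} {a b c : ℕ} (h : arrayCheck k N E T R p n a b c = true)
    {m : ZMod 3 → ZMod 3 → ℕ} (hm : IsArray (Adm k N E) T m) (ha : m 0 0 + m 0 1 + m 0 2 = a)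
    (hb : m 1 0 + m 1 1 + m 1 2 = b) (hc : m 2 0 + m 2 1 + m 2 2 = c) :
    n.evalArray m ≤ p.evalArray m ∧ (n.evalArray m = p.evalArray m →
      ∃ β, R (sq3 (m 0 0) (m 0 1) (m 0 2)) (shearCode m β) (shearCode m (1 + β))
        (shearCode m (2 + β)) = true) := by
  obtain ⟨r, hr1, hr2⟩ := exists_max_shift (m 0)
  obtain ⟨s, hs1, hs2⟩ := exists_max_shift (m 1)
  have key := arrayCheck_spec_of_max h (hm.rotate r (s - r)) (by
    rw [← ha]; exact sum_shift (m 0) _) (by rw [← hb]; exact sum_shift (m 1) _)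
    (by rw [← hc]; exact sum_shift (m 2) _) (by simpa [shearRotate] using hr1)
    (by simpa [shearRotate] using hr2) (by simpa [shearRotate] using hs1)
    (by simpa [shearRotate] using hs2)
  simp only [Weights.evalArray_rotate, shearCode_rotate, zero_add] at key
  refine ⟨key.1, fun e => ⟨s - r, ?_⟩⟩
  have h := key.2 e
  rwa [show sq3 (shearRotate m r (s - r) 0 0) (shearRotate m r (s - r) 0 1)
    (shearRotate m r (s - r) 0 2) = sq3 (m 0 0) (m 0 1) (m 0 2) from
      sq3_shift (m 0) (r + (s - r) * 0)] at h

section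
variable {V : Type*} [AddCommGroup V] [Module (ZMod 3) V]

/-- The sum of squares of the three hyperplane section sizes in direction `ξ`. -/
def code (S : Finset V) (ξ : Dual (ZMod 3) V) : ℕ := sq3 (lv S ξ 0) (lv S ξ 1) (lv S ξ 2)

theorem code_eq (S : Finset V) (ξ : Dual (ZMod 3) V) (t : ZMod 3) :
    sq3 (lv S ξ t) (lv S ξ (t + 1)) (lv S ξ (t + 2)) = code S ξ := by
  have := sq3_shift (lv S ξ) t
  rwa [zero_add, add_comm 1, add_comm 2] at this

theorem lv_neg (S : Finset V) (ξ : Dual (ZMod 3) V) (t : ZMod 3) : lv S (-ξ) t = lv S ξ (-t) := by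
  unfold lv
  simp only [LinearMap.neg_apply, neg_eq_iff_eq_neg]

theorem exists_sorted (f : ZMod 3 → ℕ) : ∃ t,
    (f (t + 1) ≤ f t ∧ f (t + 2) ≤ f (t + 1)) ∨ (f (t + 2) ≤ f t ∧ f (t + 1) ≤ f (t + 2)) := by
  obtain ⟨r, hr1, hr2⟩ := exists_max_shift f
  rw [zero_add, add_comm] at hr1
  rw [zero_add, add_comm] at hr2
  exact ⟨r, by omega⟩

/-- Up to sign, the sections in any direction are sorted by size. -/
theorem exists_sorted_direction (S : Finset V) {ξ : Dual (ZMod 3) V} (hξ : ξ ≠ 0) :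
    ∃ ζ : Dual (ZMod 3) V, ζ ≠ 0 ∧ (ζ = ξ ∨ ζ = -ξ) ∧ ∃ t, lv S ζ (t + 1) ≤ lv S ζ t ∧
      lv S ζ (t + 2) ≤ lv S ζ (t + 1) ∧ code S ζ = code S ξ ∧
      cub3 (lv S ζ t) (lv S ζ (t + 1)) (lv S ζ (t + 2)) =
        cub3 (lv S ξ 0) (lv S ξ 1) (lv S ξ 2) := by
  have hc : ∀ t, cub3 (lv S ξ t) (lv S ξ (t + 1)) (lv S ξ (t + 2)) =
      cub3 (lv S ξ 0) (lv S ξ 1) (lv S ξ 2) := by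
    intro t
    have := cub3_shift (lv S ξ) t
    rwa [zero_add, add_comm 1, add_comm 2] at this
  obtain ⟨t, ⟨h1, h2⟩ | ⟨h1, h2⟩⟩ := exists_sorted (lv S ξ)
  · exact ⟨ξ, hξ, .inl rfl, t, h1, h2, rfl, hc t⟩
  · have e1 : -(-t + 1) = t + 2 := (show ∀ t : ZMod 3, -(-t + 1) = t + 2 by decide) t
    have e2 : -(-t + 2) = t + 1 := (show ∀ t : ZMod 3, -(-t + 2) = t + 1 by decide) t
    refine ⟨-ξ, neg_ne_zero.2 hξ, .inr rfl, -t, ?_⟩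
    rw [← code_eq S (-ξ) (-t), ← code_eq S ξ t, ← hc t]
    simp only [lv_neg, e1, e2, neg_neg]
    refine ⟨h1, h2, ?_, ?_⟩
    · unfold sq3; ring
    · unfold cub3; ring

/-- The array of slice sizes in directions `ξ`, `η`. -/
def sliceArray (S : Finset V) (ξ η : Dual (ZMod 3) V) (t i j : ZMod 3) : ℕ :=
  lv (slice S ξ (t + i)) η j

theorem shearCode_sliceArray (S : Finset V) (ξ η : Dual (ZMod 3) V) (t s : ZMod 3) :
    shearCode (sliceArray S ξ η t) s = code S (η - s • ξ) := by
  have e1 : ∀ u : ZMod 3, u - s * t - -s * t = u := fun u => by ring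
  have e2 : ∀ u : ZMod 3, u - s * t - -s * (t + 1) = u + s := fun u => by ring
  have e3 : ∀ u : ZMod 3, u - s * t - -s * (t + 2) = u + s * 2 := fun u => by ring
  have h : ∀ u, lv S (η - s • ξ) (u - s * t) = sliceArray S ξ η t 0 u +
      sliceArray S ξ η t 1 (u + s) + sliceArray S ξ η t 2 (u + s * 2) := by
    intro u
    have e0 : η - s • ξ = η + (-s) • ξ := by
      ext x
      simp only [LinearMap.sub_apply, LinearMap.add_apply, LinearMap.smul_apply, smul_eq_mul]
      ring
    rw [e0, lv_add_smul S ξ η (-s) t, e1, e2, e3]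
    simp only [sliceArray, add_zero]
  rw [← code_eq S _ (0 - s * t), show 0 - s * t + 1 = 1 - s * t by ring,
    show 0 - s * t + 2 = 2 - s * t by ring, h, h, h]
  simp only [shearCode, zero_add]

end

section
variable {V : Type} [AddCommGroup V] [Module (ZMod 3) V] [Finite V]

theorem isArray_sliceArray {d k N : ℕ} {E : ℕ → ℕ → Bool} {T : ℕ → Bool}
    (h : CapAdm d (Adm k N E)) (hd : finrank (ZMod 3) V = d + 1) {S : Finset V} (hS : CapSet S)
    (hT : ∀ ζ : Dual (ZMod 3) V, ζ ≠ 0 → T (code S ζ) = true) {ξ η : Dual (ZMod 3) V}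
    (hξ : ξ ≠ 0) (hη : Indep ξ η) (t : ZMod 3) :
    IsArray (Adm k N E) T (sliceArray S ξ η t) where
  row i j := adm_slice h hd hS hξ hη (t + i) j
  trans j β := by
    have := adm_slice h hd hS (sub_ne_zero.2 (hη β)) (hη.sub_smul hξ β) (j - β * t) t
    rw [lv_slice_comm, lv_slice_comm, lv_slice_comm, show j - β * t + β * t = j by ring,
      show j - β * t + β * (t + 1) = j + β by ring,
      show j - β * t + β * (t + 2) = j + β * 2 by ring] at this
    simpa only [sliceArray, add_zero] using this
  shear s := by
    rw [shearCode_sliceArray]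
    exact hT _ (sub_ne_zero.2 (hη s))

/-- An array check whose functional has nonpositive total is sharp. -/
theorem array_bound {d k N : ℕ} {E : ℕ → ℕ → Bool} {T : ℕ → Bool} {R : ℕ → ℕ → ℕ → ℕ → Bool}
    {p n : Weights} {a b c : ℕ} (h : CapAdm d (Adm k N E)) (hd : finrank (ZMod 3) V = d + 1)
    {S : Finset V} (hS : CapSet S)
    (hT : ∀ ζ : Dual (ZMod 3) V, ζ ≠ 0 → T (code S ζ) = true)
    (hk : arrayCheck k N E T R p n a b c = true) {ξ : Dual (ZMod 3) V} (hξ : ξ ≠ 0) (t : ZMod 3)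
    (ha : lv S ξ t = a) (hb : lv S ξ (t + 1) = b) (hc : lv S ξ (t + 2) = c) :
    n.all (3 ^ d) a b c + 3 * p.dep a b c ≤ p.all (3 ^ d) a b c + 3 * n.dep a b c ∧
    (n.all (3 ^ d) a b c + 3 * p.dep a b c = p.all (3 ^ d) a b c + 3 * n.dep a b c →
      ∀ η, Indep ξ η → ∃ β : ZMod 3, R (code (slice S ξ t) η) (code S (η - β • ξ))
        (code S (η - (1 + β) • ξ)) (code S (η - (2 + β) • ξ)) = true) := by
  classical
  have : Finite (Dual (ZMod 3) V) := Module.finite_of_finite (ZMod 3)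
  have := Fintype.ofFinite (Dual (ZMod 3) V)
  have hq : Fintype.card (Dual (ZMod 3) V) = 3 * 3 ^ d := by
    rw [card_dual hd, pow_succ, mul_comm]
  have ev : ∀ (w : Weights) (η : Dual (ZMod 3) V), w.evalArr (slice S ξ t) (slice S ξ (t + 1))
      (slice S ξ (t + 2)) η = w.evalArray (sliceArray S ξ η t) := by
    intro w η
    simp only [Weights.evalArr, Weights.evalArray, sliceArray, add_zero]
  have hrow : ∀ (η : Dual (ZMod 3) V) (i : ZMod 3), lv (slice S ξ i) η 0 + lv (slice S ξ i) η 1 +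
      lv (slice S ξ i) η 2 = lv S ξ i := by
    intro η i
    have := lv_total (slice S ξ i) η 0
    rwa [zero_add, zero_add] at this
  have key : ∀ η, Indep ξ η → _ := fun η hη => arrayCheck_spec hk
    (isArray_sliceArray h hd hS hT hξ hη t)
    (by rw [← ha, ← hrow η]; simp only [sliceArray, add_zero])
    (by rw [← hb, ← hrow η]; rfl)
    (by rw [← hc, ← hrow η]; rfl)
  have ep := sum_indep hq hS hξ t p
  have en := sum_indep hq hS hξ t n
  rw [ha, hb, hc] at ep en
  simp only [ev] at ep en
  have hle := Finset.sum_le_sum (s := Finset.univ.filter fun η => Indep ξ η)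
    fun η hη => (key η (Finset.mem_filter.1 hη).2).1
  refine ⟨by omega, fun e η hη => ?_⟩
  have he := (Finset.sum_eq_sum_iff_of_le fun η hη => (key η (Finset.mem_filter.1 hη).2).1).1
    (show ∑ η with Indep ξ η, n.evalArray (sliceArray S ξ η t) = ∑ η with Indep ξ η, _ by omega)
    η (Finset.mem_filter.2 ⟨Finset.mem_univ _, hη⟩)
  simpa only [shearCode_sliceArray, sliceArray, add_zero, code] using (key η hη).2 he

end

section
variable {V : Type} [AddCommGroup V] [Module (ZMod 3) V]

/-- The condition on quadruples of codes that always holds. -/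
def anyCodes (_ _ _ _ : ℕ) : Bool := true

/-- Whether a code belongs to a list. -/
def codeIn : List ℕ → ℕ → Bool
  | [], _ => false
  | c :: l, x => bor (Nat.beq x c) (codeIn l x)

/-- Whether a code does not belong to a list. -/
def codeNotIn : List ℕ → ℕ → Bool
  | [], _ => true
  | c :: l, x => Bool.rec (codeNotIn l x) false (Nat.beq x c)

theorem codeIn_iff {l : List ℕ} {x : ℕ} : codeIn l x = true ↔ x ∈ l := by
  induction l with
  | nil => simp [codeIn]
  | cons c l ih =>
    rw [List.mem_cons, ← ih, ← Nat.beq_eq, codeIn]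
    cases Nat.beq x c <;> simp [bor]

theorem codeNotIn_iff {l : List ℕ} {x : ℕ} : codeNotIn l x = true ↔ x ∉ l := by
  induction l with
  | nil => simp [codeNotIn]
  | cons c l ih =>
    rw [List.mem_cons, not_or, ← ih, ← Nat.beq_eq, codeNotIn]
    cases Nat.beq x c <;> simp

/-- A property of sorted triples of section sizes extends to all directions. -/
theorem code_of_sorted {n M : ℕ} {T T' : ℕ → Bool} {S : Finset V} (hn : S.card = n)
    (hM : ∀ ζ : Dual (ZMod 3) V, ζ ≠ 0 → ∀ t, lv S ζ t ≤ M)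
    (hT : ∀ ζ : Dual (ZMod 3) V, ζ ≠ 0 → T (code S ζ) = true) {Q : ℕ → ℕ → ℕ → Bool}
    (hQ : rowLoop n (fun x y z => bimp (Nat.ble x M) (bimp (Nat.ble z y) (bimp (T (sq3 x y z))
      (bor (T' (sq3 x y z)) (Q x y z))))) = true)
    (H : ∀ ζ : Dual (ZMod 3) V, ζ ≠ 0 → ∀ t,
      Q (lv S ζ t) (lv S ζ (t + 1)) (lv S ζ (t + 2)) = false)
    (ξ : Dual (ZMod 3) V) (hξ : ξ ≠ 0) : T' (code S ξ) = true := by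
  obtain ⟨ζ, hζ, -, t, h1, h2, hc, -⟩ := exists_sorted_direction S hξ
  have h := bimp_spec (bimp_spec (rowLoop_spec hQ ((lv_total S ζ t).trans hn) h1 (h2.trans h1))
    (Nat.ble_eq_true_of_le (hM ζ hζ t))) (Nat.ble_eq_true_of_le h2)
  rw [code_eq, hc] at h
  have := bor_spec (bimp_spec h (hT ξ hξ))
  rwa [H ζ hζ t, or_iff_left Bool.false_ne_true] at this

/-- Whether a triple of numbers is the given one. -/
def isTriple (a b c x y z : ℕ) : Bool := Nat.beq x a && (Nat.beq y b && Nat.beq z c)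

/-- An array check of negative total rules out a triple of section sizes. -/
theorem code_of_arrayCheck [Finite V] {d k N n M a b c : ℕ} {E : ℕ → ℕ → Bool} {T : ℕ → Bool}
    (T' : ℕ → Bool) {p w : Weights} (h : CapAdm d (Adm k N E)) (hd : finrank (ZMod 3) V = d + 1)
    {S : Finset V} (hS : CapSet S) (hn : S.card = n)
    (hM : ∀ ζ : Dual (ZMod 3) V, ζ ≠ 0 → ∀ t, lv S ζ t ≤ M)
    (hT : ∀ ζ : Dual (ZMod 3) V, ζ ≠ 0 → T (code S ζ) = true)
    (hk : arrayCheck k N E T anyCodes p w a b c = true)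
    (hlt : p.all (3 ^ d) a b c + 3 * w.dep a b c < w.all (3 ^ d) a b c + 3 * p.dep a b c)
    (hQ : rowLoop n (fun x y z => bimp (Nat.ble x M) (bimp (Nat.ble z y) (bimp (T (sq3 x y z))
      (bor (T' (sq3 x y z)) (isTriple a b c x y z))))) = true) :
    ∀ ζ : Dual (ZMod 3) V, ζ ≠ 0 → T' (code S ζ) = true := by
  refine code_of_sorted hn hM hT hQ fun ζ hζ t => ?_
  rw [← Bool.not_eq_true]
  intro e
  simp only [isTriple, Bool.and_eq_true, Nat.beq_eq] at e
  exact absurd (array_bound h hd hS hT hk hζ t e.1 e.2.1 e.2.2).1 (by omega)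

/-- A linear functional of the section invariants with nonpositive total restricts the directions
to its zeros. -/
theorem code_of_total [Finite V] {d n M : ℕ} {T : ℕ → Bool} (T' : ℕ → Bool) (l0 l2 l3 : ℤ)
    (hd : finrank (ZMod 3) V = d + 1) {S : Finset V} (hS : CapSet S) (hn : S.card = n)
    (hM : ∀ ζ : Dual (ZMod 3) V, ζ ≠ 0 → ∀ t, lv S ζ t ≤ M)
    (hT : ∀ ζ : Dual (ZMod 3) V, ζ ≠ 0 → T (code S ζ) = true)
    (hQ : rowLoop n (fun x y z => bimp (Nat.ble x M) (bimp (T (sq3 x y z))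
      (bor (decide (0 < l0 + l2 * sq3 x y z + l3 * cub3 x y z))
        (decide (0 = l0 + l2 * sq3 x y z + l3 * cub3 x y z) && T' (sq3 x y z))))) = true)
    (htot : l0 * (3 * 3 ^ d - 1) + l2 * (3 ^ d * n ^ 2 + 2 * 3 ^ d * n - n ^ 2) +
      l3 * (3 ^ d * n ^ 3 + 2 * 3 ^ d * n - n ^ 3) ≤ 0) :
    ∀ ζ : Dual (ZMod 3) V, ζ ≠ 0 → T' (code S ζ) = true := by
  classical
  have : Finite (Dual (ZMod 3) V) := Module.finite_of_finite (ZMod 3)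
  have := Fintype.ofFinite (Dual (ZMod 3) V)
  have hq : Fintype.card (Dual (ZMod 3) V) = 3 * 3 ^ d := by
    rw [card_dual hd, pow_succ, mul_comm]
  have e := sum_ne_zero hq hS l0 l2 l3
  push_cast at e
  rw [hn] at e
  rw [← e] at htot
  have key : ∀ ξ : Dual (ZMod 3) V, ξ ≠ 0 →
      0 < l0 + l2 * (sq3 (lv S ξ 0) (lv S ξ 1) (lv S ξ 2) : ℤ) +
        l3 * (cub3 (lv S ξ 0) (lv S ξ 1) (lv S ξ 2) : ℤ) ∨
      (0 = l0 + l2 * (sq3 (lv S ξ 0) (lv S ξ 1) (lv S ξ 2) : ℤ) +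
        l3 * (cub3 (lv S ξ 0) (lv S ξ 1) (lv S ξ 2) : ℤ) ∧ T' (code S ξ) = true) := by
    intro ξ hξ
    obtain ⟨ζ, hζ, -, t, h1, h2, hc, hc'⟩ := exists_sorted_direction S hξ
    have h := bimp_spec (rowLoop_spec hQ ((lv_total S ζ t).trans hn) h1 (h2.trans h1))
      (Nat.ble_eq_true_of_le (hM ζ hζ t))
    rw [code_eq, hc, hc'] at h
    have := bor_spec (bimp_spec h (hT ξ hξ))
    rwa [Bool.and_eq_true, decide_eq_true_eq, decide_eq_true_eq] at this
  have hnn : ∀ ξ ∈ Finset.univ.filter (fun ξ : Dual (ZMod 3) V => ξ ≠ 0),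
      0 ≤ l0 + l2 * (sq3 (lv S ξ 0) (lv S ξ 1) (lv S ξ 2) : ℤ) +
        l3 * (cub3 (lv S ξ 0) (lv S ξ 1) (lv S ξ 2) : ℤ) := by
    intro ξ hξ
    rcases key ξ (Finset.mem_filter.1 hξ).2 with h | h
    · exact h.le
    · exact h.1.le
  have hz := (Finset.sum_eq_zero_iff_of_nonneg hnn).1 (le_antisymm htot (Finset.sum_nonneg hnn))
  intro ζ hζ
  rcases key ζ hζ with h | h
  · exact absurd (hz ζ (Finset.mem_filter.2 ⟨Finset.mem_univ _, hζ⟩)) h.ne'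
  · exact h.2

theorem exists_dual_ne_zero {d : ℕ} (hd : finrank (ZMod 3) V = d + 1) :
    ∃ ζ : Dual (ZMod 3) V, ζ ≠ 0 := by
  have : Nontrivial (Dual (ZMod 3) V) := by
    apply Module.nontrivial_of_finrank_pos (R := ZMod 3)
    rw [Subspace.dual_finrank_eq, hd]
    omega
  exact exists_ne 0

theorem code_neg (S : Finset V) (ξ : Dual (ZMod 3) V) : code S (-ξ) = code S ξ := by
  unfold code
  rw [lv_neg, lv_neg, lv_neg, neg_zero, show -(1 : ZMod 3) = 2 by decide,
    show -(2 : ZMod 3) = 1 by decide]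
  unfold sq3; ring

theorem code_smul (S : Finset V) {ξ : Dual (ZMod 3) V} {γ : ZMod 3} (h : γ ≠ 0) :
    code S (γ • ξ) = code S ξ := by
  obtain rfl | rfl | rfl := zmod3_cases γ
  · exact absurd rfl h
  · rw [one_smul]
  · rw [← code_neg, ← neg_one_smul (ZMod 3), smul_smul, show (-1 : ZMod 3) * 2 = 1 by decide,
      one_smul]

theorem CapBound.of_forall_ne {d N : ℕ} (h : ∀ (V : Type) [AddCommGroup V] [Module (ZMod 3) V]
    [Finite V], finrank (ZMod 3) V = d → ∀ S : Finset V, CapSet S → S.card ≠ N + 1) :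
    CapBound d N := by
  intro V _ _ _ hd S hS
  by_contra! hlt
  obtain ⟨A, hA, hc⟩ := Finset.exists_subset_card_eq (Nat.succ_le_of_lt hlt)
  exact h V hd A (hS.subset hA) hc

theorem capBound_succ_of_total {d M N : ℕ} (l0 l2 l3 : ℤ) (h : CapBound d M)
    (hQ : rowLoop (N + 1) (fun x y z => bimp (Nat.ble x M) (bimp (codeNotIn [] (sq3 x y z))
      (bor (decide (0 < l0 + l2 * sq3 x y z + l3 * cub3 x y z))
        (decide (0 = l0 + l2 * sq3 x y z + l3 * cub3 x y z) && codeIn [] (sq3 x y z))))) = true)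
    (htot : l0 * (3 * 3 ^ d - 1) + l2 * (3 ^ d * (N + 1 : ℕ) ^ 2 + 2 * 3 ^ d * (N + 1 : ℕ) -
      (N + 1 : ℕ) ^ 2) + l3 * (3 ^ d * (N + 1 : ℕ) ^ 3 + 2 * 3 ^ d * (N + 1 : ℕ) -
      (N + 1 : ℕ) ^ 3) ≤ 0) : CapBound (d + 1) N := by
  refine CapBound.of_forall_ne fun V _ _ _ hd S hS hn => ?_
  obtain ⟨ζ, hζ⟩ := exists_dual_ne_zero hd
  simpa [codeIn] using code_of_total (codeIn []) l0 l2 l3 hd hS hn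
    (fun ζ hζ t => lv_le_of_bound h hd hS hζ t) (fun _ _ => rfl) hQ htot ζ hζ

theorem capAdm_succ {d k N : ℕ} {E : ℕ → ℕ → Bool} (hk : CapBound d k) (hN : CapBound (d + 1) N)
    (hE : ∀ (V : Type) [AddCommGroup V] [Module (ZMod 3) V] [Finite V],
      finrank (ZMod 3) V = d + 1 → ∀ S : Finset V, CapSet S → S.card ≤ N →
        ∀ ξ : Dual (ZMod 3) V, ξ ≠ 0 → E S.card (code S ξ) = true) :
    CapAdm (d + 1) (Adm k N E) := by
  intro V _ _ _ hd S hS ξ hξ t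
  have hl := fun t => lv_le_of_bound hk hd hS hξ t
  refine ⟨hl _, hl _, hl _, ?_⟩
  rw [lv_total, code_eq]
  exact ⟨hN V hd S hS, hE V hd S hS (hN V hd S hS) ξ hξ⟩

end

theorem capBound_zero : CapBound 0 1 := by
  intro V _ _ _ hd S _
  have : Module.Finite (ZMod 3) V := inferInstance
  have := Module.finrank_zero_iff.1 hd
  exact Finset.card_le_one.2 fun a _ b _ => Subsingleton.elim a b

theorem capBound_one : CapBound 1 2 :=
  capBound_succ_of_total (-8) 0 1 capBound_zero (by decide +kernel) (by decide)

theorem capBound_two : CapBound 2 4 :=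
  capBound_succ_of_total 10 (-1) 0 capBound_one (by decide +kernel) (by decide)

theorem capBound_three : CapBound 3 9 :=
  capBound_succ_of_total 37 (-1) 0 capBound_two (by decide +kernel) (by decide)

/-- Section sums of squares of the extremal caps in dimension three. -/
def codes3 (s c : ℕ) : Bool := bor (Nat.ble s 8) (codeIn [27, 33] c)

/-- Section sums of squares of the large caps in dimension four. -/
def codes4 (s c : ℕ) : Bool :=
  bor (Nat.ble s 18) (bor (Nat.beq s 19 && codeIn [163, 149, 125, 121] c)
    (Nat.beq s 20 && codeIn [136, 166] c))

/-- Section sums of squares of the extremal caps in dimension five. -/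
def codes5 (s c : ℕ) : Bool := bor (Nat.ble s 44) (codeIn [675, 729] c)

section
variable {V : Type} [AddCommGroup V] [Module (ZMod 3) V] [Finite V]

theorem code_card_nine (hd : finrank (ZMod 3) V = 3) {S : Finset V} (hS : CapSet S)
    (hn : S.card = 9) : ∀ ξ : Dual (ZMod 3) V, ξ ≠ 0 → codeIn [27, 33] (code S ξ) = true :=
  code_of_total (T := codeNotIn []) _ (-972) 9 3 hd hS hn
    (fun _ h t => lv_le_of_bound capBound_two hd hS h t)
    (fun _ _ => rfl) (by decide +kernel) (by decide)

end

theorem bor_true_right {b x : Bool} (h : x = true) : bor b x = true := by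
  cases b
  · exact h
  · rfl

theorem bor_true_left {b x : Bool} (h : b = true) : bor b x = true := by
  subst h; rfl

theorem capAdm_three : CapAdm 3 (Adm 4 9 codes3) := by
  refine capAdm_succ capBound_two capBound_three fun V _ _ _ hd S hS hN ξ hξ => ?_
  rcases Nat.lt_succ_iff_lt_or_eq.1 (Nat.lt_succ_of_le hN) with h | h
  · exact bor_true_left (Nat.ble_eq_true_of_le (Nat.le_of_lt_succ h))
  · exact bor_true_right (code_card_nine hd hS h ξ hξ)

section
variable {V : Type} [AddCommGroup V] [Module (ZMod 3) V] [Finite V]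

theorem capBound_four : CapBound 4 20 := by
  refine CapBound.of_forall_ne fun V _ _ _ hd S hS hn => ?_
  have hM : ∀ ζ : Dual (ZMod 3) V, ζ ≠ 0 → ∀ t, lv S ζ t ≤ 9 :=
    fun _ h t => lv_le_of_bound capBound_three hd hS h t
  have h1 := code_of_total (T := codeNotIn []) (codeIn [147, 171]) (-11907) 18 3 hd hS hn hM
    (fun _ _ => rfl) (by decide +kernel) (by decide)
  have h2 := code_of_arrayCheck (a := 9) (b := 9) (c := 3) (codeIn [147])
    (p := ⟨57, 0, 0, 0, 0, 0, 0, 0⟩) (w := ⟨0, 1, 1, 1, 0, 0, 0, 0⟩) capAdm_three hd hS hn hM h1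
    (by decide +kernel) (by decide) (by decide +kernel)
  obtain ⟨ζ, hζ⟩ := exists_dual_ne_zero hd
  exact absurd (code_of_total (codeIn []) 148 (-1) 0 hd hS hn hM h2 (by decide +kernel)
    (by decide) ζ hζ) Bool.false_ne_true

theorem code_card_twenty (hd : finrank (ZMod 3) V = 4) {S : Finset V} (hS : CapSet S)
    (hn : S.card = 20) : ∀ ξ : Dual (ZMod 3) V, ξ ≠ 0 → codeIn [136, 166] (code S ξ) = true := by
  have hM : ∀ ζ : Dual (ZMod 3) V, ζ ≠ 0 → ∀ t, lv S ζ t ≤ 9 :=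
    fun _ h t => lv_le_of_bound capBound_three hd hS h t
  have h1 := code_of_arrayCheck (T := codeNotIn []) (a := 7) (b := 7) (c := 6) (codeNotIn [134])
    (p := ⟨0, 0, 0, 1, 1, 1, 0, 1⟩) (w := ⟨231, 0, 5, 0, 0, 0, 0, 0⟩) capAdm_three hd hS hn hM
    (fun _ _ => rfl) (by decide +kernel) (by decide) (by decide +kernel)
  exact code_of_total _ (-55992) 117 15 hd hS hn hM h1 (by decide +kernel) (by decide)

/-- A cap of size nineteen in dimension four has sections of sizes nine, nine and one. -/
theorem exists_code_card_nineteen (hd : finrank (ZMod 3) V = 4) {S : Finset V} (hS : CapSet S)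
    (hn : S.card = 19) : ∃ ξ : Dual (ZMod 3) V, ξ ≠ 0 ∧ code S ξ = 163 := by
  have hM : ∀ ζ : Dual (ZMod 3) V, ζ ≠ 0 → ∀ t, lv S ζ t ≤ 9 :=
    fun _ h t => lv_le_of_bound capBound_three hd hS h t
  by_contra! h0
  have h1 : ∀ ζ : Dual (ZMod 3) V, ζ ≠ 0 → codeNotIn [163] (code S ζ) = true :=
    fun ζ hζ => codeNotIn_iff.2 (by simpa using h0 ζ hζ)
  have h2 := code_of_arrayCheck (a := 9) (b := 7) (c := 3) (codeNotIn [163, 139])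
    (p := ⟨0, 8, 3, 4, 3, 1, 0, 3⟩) (w := ⟨1296, 0, 0, 0, 0, 0, 1, 0⟩) capAdm_three hd hS hn hM h1
    (by decide +kernel) (by decide) (by decide +kernel)
  have h3 := code_of_arrayCheck (a := 8) (b := 7) (c := 4) (codeNotIn [163, 139, 129])
    (p := ⟨0, 10, 22, 30, 1, 3, 6, 26⟩) (w := ⟨3343, 0, 0, 0, 0, 0, 0, 0⟩) capAdm_three hd hS hn
    hM h2 (by decide +kernel) (by decide) (by decide +kernel)
  have h4 := code_of_arrayCheck (a := 9) (b := 8) (c := 2) (codeNotIn [163, 139, 129, 149])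
    (p := ⟨0, 22, 0, 0, 5, 1, 17, 5⟩) (w := ⟨2109, 0, 2, 50, 0, 0, 0, 0⟩) capAdm_three hd hS hn
    hM h3 (by decide +kernel) (by decide) (by decide +kernel)
  have h5 := code_of_arrayCheck (a := 8) (b := 8) (c := 3) (codeNotIn [163, 139, 129, 149, 137])
    (p := ⟨55, 0, 0, 0, 0, 0, 0, 0⟩) (w := ⟨0, 1, 1, 1, 0, 0, 0, 0⟩) capAdm_three hd hS hn
    hM h4 (by decide +kernel) (by decide) (by decide +kernel)
  obtain ⟨ζ, hζ⟩ := exists_dual_ne_zero hd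
  exact absurd (code_of_total (codeIn []) (-8288) 12 3 hd hS hn hM h5 (by decide +kernel)
    (by decide) ζ hζ) Bool.false_ne_true

end

theorem forall_of_shift {P : ZMod 3 → Prop} {β : ZMod 3} (h0 : P β) (h1 : P (1 + β))
    (h2 : P (2 + β)) (s : ZMod 3) : P s := by
  obtain h | h | h := zmod3_cases (s - β)
  · rwa [sub_eq_zero.1 h]
  · rwa [sub_eq_iff_eq_add.1 h]
  · rwa [sub_eq_iff_eq_add.1 h]

section
variable {V : Type} [AddCommGroup V] [Module (ZMod 3) V]

theorem exists_sections_of_code {n M a b c X : ℕ} {S : Finset V} (hn : S.card = n)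
    (hM : ∀ ζ : Dual (ZMod 3) V, ζ ≠ 0 → ∀ t, lv S ζ t ≤ M) {ξ : Dual (ZMod 3) V} (hξ : ξ ≠ 0)
    (hX : code S ξ = X)
    (hQ : rowLoop n (fun x y z => bimp (Nat.ble x M) (bimp (Nat.ble z y)
      (bimp (Nat.beq (sq3 x y z) X) (isTriple a b c x y z)))) = true) :
    ∃ ζ : Dual (ZMod 3) V, ζ ≠ 0 ∧ (ζ = ξ ∨ ζ = -ξ) ∧
      ∃ t, lv S ζ t = a ∧ lv S ζ (t + 1) = b ∧ lv S ζ (t + 2) = c := by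
  obtain ⟨ζ, hζ, hζ', t, h1, h2, hc, -⟩ := exists_sorted_direction S hξ
  refine ⟨ζ, hζ, hζ', t, ?_⟩
  have h := bimp_spec (bimp_spec (bimp_spec (rowLoop_spec hQ ((lv_total S ζ t).trans hn) h1
    (h2.trans h1)) (Nat.ble_eq_true_of_le (hM ζ hζ t))) (Nat.ble_eq_true_of_le h2))
    (by rw [Nat.beq_eq, code_eq, hc, hX])
  simpa only [isTriple, Bool.and_eq_true, Nat.beq_eq] using h

/-- Whether the last three codes belong to a list. -/
def allCodesIn (l : List ℕ) (_ x y z : ℕ) : Bool := codeIn l x && (codeIn l y && codeIn l z)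

theorem code_card_nineteen [Finite V] (hd : finrank (ZMod 3) V = 4) {S : Finset V} (hS : CapSet S)
    (hn : S.card = 19) :
    ∀ ξ : Dual (ZMod 3) V, ξ ≠ 0 → codeIn [163, 149, 125, 121] (code S ξ) = true := by
  have hM : ∀ ζ : Dual (ZMod 3) V, ζ ≠ 0 → ∀ t, lv S ζ t ≤ 9 :=
    fun _ h t => lv_le_of_bound capBound_three hd hS h t
  obtain ⟨ξ, hξ, hX⟩ := exists_code_card_nineteen hd hS hn
  obtain ⟨ζ, hζ, -, t, ha, hb, hc⟩ := exists_sections_of_code (a := 9) (b := 9) (c := 1) hn hM hξ hX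
    (by decide +kernel)
  have key := (array_bound (T := codeNotIn []) (R := allCodesIn [163, 149, 125, 121])
    (p := ⟨0, 3, 3, 0, 0, 0, 0, 12⟩) (n := ⟨486, 0, 0, 0, 0, 0, 0, 0⟩) capAdm_three hd hS
    (fun _ _ => rfl) (by decide +kernel) hζ t ha hb hc).2 (by decide)
  intro η hη
  by_cases hi : Indep ζ η
  · obtain ⟨β, hβ⟩ := key η hi
    simp only [allCodesIn, Bool.and_eq_true] at hβ
    simpa using forall_of_shift (P := fun s => codeIn [163, 149, 125, 121] (code S (η - s • ζ)) =
      true) hβ.1 hβ.2.1 hβ.2.2 0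
  · unfold Indep at hi
    push Not at hi
    obtain ⟨γ, rfl⟩ := hi
    rw [code_smul S (fun h => hη (by rw [h, zero_smul])), ← code_eq S ζ t, ha, hb, hc]
    decide

end

theorem capAdm_four : CapAdm 4 (Adm 9 20 codes4) := by
  refine capAdm_succ capBound_three capBound_four fun V _ _ _ hd S hS hN ξ hξ => ?_
  obtain h | h | h : S.card ≤ 18 ∨ S.card = 19 ∨ S.card = 20 := by omega
  · exact bor_true_left (Nat.ble_eq_true_of_le h)
  · refine bor_true_right (bor_true_left ?_)
    rw [h, code_card_nineteen hd hS h ξ hξ]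
    rfl
  · refine bor_true_right (bor_true_right ?_)
    rw [h, code_card_twenty hd hS h ξ hξ]
    rfl

theorem code_card_forty_five {V : Type} [AddCommGroup V] [Module (ZMod 3) V] [Finite V]
    (hd : finrank (ZMod 3) V = 5) {S : Finset V} (hS : CapSet S) (hn : S.card = 45) :
    ∀ ξ : Dual (ZMod 3) V, ξ ≠ 0 → codeIn [675, 729] (code S ξ) = true := by
  have hM : ∀ ζ : Dual (ZMod 3) V, ζ ≠ 0 → ∀ t, lv S ζ t ≤ 20 :=
    fun _ h t => lv_le_of_bound capBound_four hd hS h t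
  have h1 := code_of_arrayCheck (T := codeNotIn []) (a := 20) (b := 20) (c := 5) (codeNotIn [825])
    (p := ⟨89221, 0, 0, 8, 0, 0, 0, 10⟩) (w := ⟨0, 97, 97, 0, 13, 13, 1, 0⟩) capAdm_four hd hS hn
    hM (fun _ _ => rfl) (by decide +kernel) (by decide) (by decide +kernel)
  have h2 := code_of_arrayCheck (a := 20) (b := 19) (c := 6) (codeNotIn [825, 797])
    (p := ⟨2731, 0, 1, 1, 0, 0, 0, 1⟩) (w := ⟨0, 7, 0, 0, 1, 0, 0, 0⟩) capAdm_four hd hS hn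
    hM h1 (by decide +kernel) (by decide) (by decide +kernel)
  have h3 := code_of_arrayCheck (a := 20) (b := 18) (c := 7) (codeNotIn [825, 797, 773])
    (p := ⟨84458, 0, 43, 23, 0, 4, 3, 24⟩) (w := ⟨0, 237, 0, 0, 32, 0, 0, 0⟩) capAdm_four hd hS hn
    hM h2 (by decide +kernel) (by decide) (by decide +kernel)
  have h4 := code_of_arrayCheck (a := 19) (b := 19) (c := 7) (codeNotIn [825, 797, 773, 771])
    (p := ⟨0, 3, 11, 3, 0, 1, 0, 5⟩) (w := ⟨8238, 0, 0, 0, 0, 0, 0, 0⟩) capAdm_four hd hS hn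
    hM h3 (by decide +kernel) (by decide) (by decide +kernel)
  have h5 := code_of_arrayCheck (a := 19) (b := 18) (c := 8) (codeNotIn [825, 797, 773, 771, 749])
    (p := ⟨0, 3, 124, 103, 0, 13, 14, 58⟩) (w := ⟨91979, 0, 0, 0, 2, 0, 0, 0⟩) capAdm_four hd hS
    hn hM h4 (by decide +kernel) (by decide) (by decide +kernel)
  exact code_of_total _ (-109350) 27 3 hd hS hn hM h5 (by decide +kernel) (by decide)

theorem capBound_five : CapBound 5 45 := by
  refine CapBound.of_forall_ne fun V _ _ _ hd S hS hn => ?_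
  classical
  have hM : ∀ ζ : Dual (ZMod 3) V, ζ ≠ 0 → ∀ t, lv S ζ t ≤ 18 := by
    intro ζ hζ t
    by_contra! hlt
    have h20 := lv_le_of_bound capBound_four hd hS hζ t
    obtain ⟨x, hx, hxt⟩ : ∃ x ∈ S, ζ x ≠ t := by
      by_contra! h
      have : lv S ζ t = S.card := by unfold lv; rw [Finset.filter_true_of_mem h]
      omega
    have hA : (S.erase x).card = 45 := by rw [Finset.card_erase_of_mem hx, hn]
    have hlv : lv (S.erase x) ζ t = lv S ζ t := by
      unfold lv
      rw [Finset.filter_erase, Finset.erase_eq_of_notMem]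
      simp [hxt]
    have hc := code_card_forty_five hd (hS.subset (Finset.erase_subset x S)) hA ζ hζ
    have hs := lv_total (S.erase x) ζ t
    rw [← code_eq _ _ t, hlv, codeIn_iff] at hc
    rw [hlv, hA] at hs
    generalize lv (S.erase x) ζ (t + 1) = b, lv (S.erase x) ζ (t + 2) = c, lv S ζ t = a at *
    obtain rfl : c = 45 - a - b := by omega
    have hb : b ≤ 26 := by omega
    clear hs hlv
    interval_cases a <;> interval_cases b <;> revert hc <;> decide
  obtain ⟨ζ, hζ⟩ := exists_dual_ne_zero hd
  exact absurd (code_of_total (T := codeNotIn []) (codeIn []) (-114152) 24 3 hd hS hn hM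
    (fun _ _ => rfl) (by decide +kernel) (by decide) ζ hζ) Bool.false_ne_true

theorem capAdm_five : CapAdm 5 (Adm 20 45 codes5) := by
  refine capAdm_succ capBound_four capBound_five fun V _ _ _ hd S hS hN ξ hξ => ?_
  rcases Nat.lt_succ_iff_lt_or_eq.1 (Nat.lt_succ_of_le hN) with h | h
  · exact bor_true_left (Nat.ble_eq_true_of_le (Nat.le_of_lt_succ h))
  · exact bor_true_right (code_card_forty_five hd hS h ξ hξ)

section
variable {V : Type} [AddCommGroup V] [Module (ZMod 3) V] [Finite V]

set_option maxHeartbeats 4000000 in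
theorem exists_code_card_one_hundred_twelve (hd : finrank (ZMod 3) V = 6) {S : Finset V}
    (hS : CapSet S) (hn : S.card = 112) :
    ∃ ξ : Dual (ZMod 3) V, ξ ≠ 0 ∧ code S ξ = 4534 := by
  have hM : ∀ ζ : Dual (ZMod 3) V, ζ ≠ 0 → ∀ t, lv S ζ t ≤ 45 :=
    fun _ h t => lv_le_of_bound capBound_five hd hS h t
  by_contra! h0
  have h1 : ∀ ζ : Dual (ZMod 3) V, ζ ≠ 0 → codeNotIn [4534] (code S ζ) = true :=
    fun ζ hζ => codeNotIn_iff.2 (by simpa using h0 ζ hζ)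
  have h2 := code_of_arrayCheck (a := 45) (b := 44) (c := 23) (codeNotIn [4534, 4490])
    (p := ⟨0, 325, 145, 31, 30, 9, 0, 30⟩) (w := ⟨1936299, 0, 0, 0, 0, 0, 1, 0⟩) capAdm_five hd
    hS hn hM h1 (by decide +kernel) (by decide) (by decide +kernel)
  have h3 := code_of_arrayCheck (a := 45) (b := 43) (c := 24) (codeNotIn [4534, 4490, 4450])
    (p := ⟨0, 396, 192, 41, 37, 11, 0, 37⟩) (w := ⟨2376992, 0, 0, 0, 0, 0, 1, 0⟩) capAdm_five hd
    hS hn hM h2 (by decide +kernel) (by decide) (by decide +kernel)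
  have h4 := code_of_arrayCheck (a := 44) (b := 44) (c := 24) (codeNotIn [4534, 4490, 4450, 4448])
    (p := ⟨0, 4660, 4660, 1793, 267, 267, 38, 1051⟩) (w := ⟨37980364, 0, 0, 0, 0, 0, 0, 0⟩)
    capAdm_five hd hS hn hM h3 (by decide +kernel) (by decide) (by decide +kernel)
  obtain ⟨ζ, hζ⟩ := exists_dual_ne_zero hd
  exact absurd (code_of_total (codeIn []) (-1643236) 57 3 hd hS hn hM h4 (by decide +kernel)
    (by decide) ζ hζ) Bool.false_ne_true

/-- Possible codes of three directions in a pencil through a special direction, in terms of the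
code of the largest section. -/
def pencilCodes (r x y z : ℕ) : Bool :=
  bor (Nat.beq r 675 && (Nat.beq x y && Nat.beq y z)) (codeIn [4534, 4192] x &&
    (codeIn [4534, 4192] y && (codeIn [4534, 4192] z &&
      bor (Nat.beq x 4534) (bor (Nat.beq y 4534) (Nat.beq z 4534)))))

theorem exists_special_section (hd : finrank (ZMod 3) V = 6) {S : Finset V} (hS : CapSet S)
    (hn : S.card = 112) {ξ : Dual (ZMod 3) V} (hξ : ξ ≠ 0) (hX : code S ξ = 4534) :
    ∃ ζ : Dual (ZMod 3) V, ζ ≠ 0 ∧ (ζ = ξ ∨ ζ = -ξ) ∧ ∃ t, lv S ζ t = 45 ∧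
      ∀ η, Indep ζ η → ∃ β : ZMod 3, pencilCodes (code (slice S ζ t) η) (code S (η - β • ζ))
        (code S (η - (1 + β) • ζ)) (code S (η - (2 + β) • ζ)) = true := by
  have hM : ∀ ζ : Dual (ZMod 3) V, ζ ≠ 0 → ∀ t, lv S ζ t ≤ 45 :=
    fun _ h t => lv_le_of_bound capBound_five hd hS h t
  obtain ⟨ζ, hζ, hζ', t, ha, hb, hc⟩ := exists_sections_of_code (a := 45) (b := 45) (c := 22)
    hn hM hξ hX (by decide +kernel)
  exact ⟨ζ, hζ, hζ', t, ha, (array_bound (T := codeNotIn []) (R := pencilCodes)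
    (p := ⟨0, 15, 15, 0, 0, 0, 0, 6⟩) (n := ⟨109350, 0, 0, 0, 0, 0, 0, 0⟩) capAdm_five hd hS
    (fun _ _ => rfl) (by decide +kernel) hζ t ha hb hc).2 (by decide)⟩

end

section
variable {V : Type} [AddCommGroup V] [Module (ZMod 3) V]

theorem finrank_dual_eq {d : ℕ} (hd : finrank (ZMod 3) V = d) :
    finrank (ZMod 3) (Dual (ZMod 3) V) = d := by
  rw [Subspace.dual_finrank_eq, hd]

/-- The directions whose sections have sizes `45`, `45` and `22`. -/
def special (S : Finset V) : Set (Dual (ZMod 3) V) := {ξ | ξ ≠ 0 ∧ code S ξ = 4534}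

theorem mem_pencil {ζ η : Dual (ZMod 3) V} {S : Finset V} {β : ZMod 3} {r : ℕ}
    (h : pencilCodes r (code S (η - β • ζ)) (code S (η - (1 + β) • ζ))
      (code S (η - (2 + β) • ζ)) = true) :
    (r = 675 ∧ ∀ s : ZMod 3, code S (η - s • ζ) = code S η) ∨
      ((∀ s : ZMod 3, code S (η - s • ζ) ∈ [4534, 4192]) ∧
        ∃ s : ZMod 3, code S (η - s • ζ) = 4534) := by
  rcases bor_spec h with h | h
  · simp only [Bool.and_eq_true, Nat.beq_eq] at h
    obtain ⟨hr, h1, h2⟩ := h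
    have h3 := forall_of_shift (P := fun s => code S (η - s • ζ) = code S (η - β • ζ)) rfl h1.symm
      (h2.symm.trans h1.symm)
    refine Or.inl ⟨hr, fun s => ?_⟩
    have h0 := h3 0
    rw [zero_smul, sub_zero] at h0
    exact (h3 s).trans h0.symm
  · simp only [Bool.and_eq_true, codeIn_iff] at h
    obtain ⟨h1, h2, h3, h4⟩ := h
    refine Or.inr ⟨forall_of_shift (P := fun s => code S (η - s • ζ) ∈ [4534, 4192]) h1 h2 h3, ?_⟩
    rcases bor_spec h4 with h | h
    · exact ⟨_, Nat.eq_of_beq_eq_true h⟩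
    · rcases bor_spec h with h | h
      · exact ⟨_, Nat.eq_of_beq_eq_true h⟩
      · exact ⟨_, Nat.eq_of_beq_eq_true h⟩

end

section
variable {V : Type} [AddCommGroup V] [Module (ZMod 3) V] [Finite V]

open Classical in
theorem card_filter_code_slice [Fintype (Dual (ZMod 3) V)] (hd : finrank (ZMod 3) V = 6)
    {S : Finset V} (hS : CapSet S) {ζ : Dual (ZMod 3) V} (hζ : ζ ≠ 0) {t : ZMod 3}
    (ht : lv S ζ t = 45) :
    (Finset.univ.filter fun η => Indep ζ η ∧ code (slice S ζ t) η ≠ 675).card = 330 := by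
  have hq : Fintype.card (Dual (ZMod 3) V) = 3 * 243 := by rw [card_dual hd]; norm_num
  have e1 := sum_indep hq hS hζ t ⟨1, 0, 0, 0, 0, 0, 0, 0⟩
  have e2 := sum_indep hq hS hζ t ⟨0, 1, 0, 0, 0, 0, 0, 0⟩
  simp only [Weights.evalArr, Weights.eval, Weights.dep, Weights.all, ht, zero_mul, one_mul,
    add_zero, zero_add, Finset.sum_const, smul_eq_mul, mul_one] at e1 e2
  have h : ∀ η, Indep ζ η → code (slice S ζ t) η =
      675 + 54 * if code (slice S ζ t) η ≠ 675 then 1 else 0 := by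
    intro η hη
    obtain ⟨-, -, -, -, h⟩ := adm_slice capAdm_five hd hS hζ hη t 0
    rw [lv_total, code_eq] at h
    change codes5 (lv S ζ t) _ = true at h
    rw [ht] at h
    have h' : code (slice S ζ t) η ∈ [675, 729] := codeIn_iff.1 h
    simp only [List.mem_cons, List.not_mem_nil, or_false] at h'
    obtain h' | h' := h' <;> simp [h']
  have e3 : ∑ η with Indep ζ η, code (slice S ζ t) η =
      ∑ η with Indep ζ η, (675 + 54 * if code (slice S ζ t) η ≠ 675 then 1 else 0) :=
    Finset.sum_congr rfl fun η hη => h η (Finset.mem_filter.1 hη).2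
  change ∑ η with Indep ζ η, code (slice S ζ t) η + _ = _ at e2
  rw [Finset.sum_add_distrib, ← Finset.mul_sum, ← Finset.card_filter, Finset.filter_filter,
    Finset.sum_const, smul_eq_mul] at e3
  omega

theorem span_special (hd : finrank (ZMod 3) V = 6) {S : Finset V} (hS : CapSet S)
    (hn : S.card = 112) : Submodule.span (ZMod 3) (special S) = ⊤ := by
  classical
  have : Finite (Dual (ZMod 3) V) := Module.finite_of_finite (ZMod 3)
  have := Fintype.ofFinite (Dual (ZMod 3) V)
  obtain ⟨ξ, hξ, hX⟩ := exists_code_card_one_hundred_twelve hd hS hn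
  obtain ⟨ζ, hζ, hζ', t, ht, H⟩ := exists_special_section hd hS hn hξ hX
  have hc := card_filter_code_slice hd hS hζ ht
  have hX' : code S ζ = 4534 := by
    rcases hζ' with rfl | rfl
    · exact hX
    · rw [code_neg, hX]
  by_contra hU
  have hlt := Submodule.finrank_lt hU
  rw [finrank_dual_eq hd] at hlt
  set U := Submodule.span (ZMod 3) (special S) with hUdef
  have hζU : ζ ∈ U := Submodule.subset_span ⟨hζ, hX'⟩
  have hcard : Nat.card U ≤ 3 ^ 5 := by
    rw [Module.natCard_eq_pow_finrank (K := ZMod 3), Nat.card_zmod]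
    exact Nat.pow_le_pow_right (by norm_num) (by omega)
  have hsub : (Finset.univ.filter fun η => Indep ζ η ∧ code (slice S ζ t) η ≠ 675) ⊆
      (Finset.univ.filter fun η => η ∈ U) := by
    intro η hη
    rw [Finset.mem_filter] at hη ⊢
    obtain ⟨-, hη, hr⟩ := hη
    obtain ⟨β, hβ⟩ := H η hη
    rcases mem_pencil hβ with h | ⟨-, s, hs⟩
    · exact absurd h.1 hr
    · refine ⟨Finset.mem_univ _, ?_⟩
      have : η - s • ζ ∈ U := Submodule.subset_span ⟨sub_ne_zero.2 (hη s), hs⟩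
      simpa using U.add_mem this (U.smul_mem s hζU)
  have := Finset.card_le_card hsub
  rw [hc, ← Fintype.card_subtype, ← Nat.card_eq_fintype_card] at this
  have h' : Nat.card {η // η ∈ U} ≤ 3 ^ 5 := hcard
  omega

theorem code_add_special (hd : finrank (ZMod 3) V = 6) {S : Finset V} (hS : CapSet S)
    (hn : S.card = 112) {ξ η : Dual (ZMod 3) V} (hξ : ξ ∈ special S)
    (hη : η ≠ 0 ∧ code S η ∉ [4534, 4192]) : η + ξ ≠ 0 ∧ code S (η + ξ) ∉ [4534, 4192] := by
  obtain ⟨ζ, hζ, hζ', t, -, H⟩ := exists_special_section hd hS hn hξ.1 hξ.2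
  have hX' : code S ζ = 4534 := by
    rcases hζ' with rfl | rfl
    · exact hξ.2
    · rw [code_neg, hξ.2]
  have hi : Indep ζ η := by
    rintro γ rfl
    refine hη.2 ?_
    rw [code_smul S (fun h => hη.1 (by rw [h, zero_smul])), hX']
    decide
  obtain ⟨β, hβ⟩ := H η hi
  obtain ⟨s, hs⟩ : ∃ s : ZMod 3, η + ξ = η - s • ζ := by
    rcases hζ' with rfl | rfl
    · refine ⟨-1, LinearMap.ext fun x => ?_⟩
      simp only [LinearMap.add_apply, LinearMap.sub_apply, LinearMap.smul_apply, smul_eq_mul]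
      ring
    · exact ⟨1, by rw [one_smul, sub_neg_eq_add]⟩
  rw [hs]
  refine ⟨sub_ne_zero.2 (hi s), ?_⟩
  rcases mem_pencil hβ with h | ⟨h, -⟩
  · rw [h.2 s]
    exact hη.2
  · refine absurd ?_ hη.2
    simpa using h 0

theorem code_mem (hd : finrank (ZMod 3) V = 6) {S : Finset V} (hS : CapSet S)
    (hn : S.card = 112) {η : Dual (ZMod 3) V} (hη : η ≠ 0) : code S η = 4534 ∨ code S η = 4192 := by
  by_contra hc
  have hc' : code S η ∉ [4534, 4192] := by simpa using hc
  have key : ∀ v ∈ Submodule.span (ZMod 3) (special S), ∀ ζ : Dual (ZMod 3) V,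
      (ζ ≠ 0 ∧ code S ζ ∉ [4534, 4192]) → (ζ + v ≠ 0 ∧ code S (ζ + v) ∉ [4534, 4192]) := by
    intro v hv
    induction hv using Submodule.span_induction with
    | mem ξ hξ => exact fun ζ hζ => code_add_special hd hS hn hξ hζ
    | zero => simp
    | add u v _ _ hu hv =>
      intro ζ hζ
      rw [← add_assoc]
      exact hv _ (hu _ hζ)
    | smul a v _ hv =>
      intro ζ hζ
      obtain rfl | rfl | rfl := zmod3_cases a
      · simpa using hζ
      · simpa using hv ζ hζ
      · rw [two_smul, ← add_assoc]
        exact hv _ (hv _ hζ)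
  have := (key (-η) (by rw [span_special hd hS hn]; trivial) η ⟨hη, hc'⟩).1
  simp at this

open Classical in
theorem card_special [Fintype (Dual (ZMod 3) V)] (hd : finrank (ZMod 3) V = 6) {S : Finset V}
    (hS : CapSet S) (hn : S.card = 112) :
    (Finset.univ.filter fun ξ => ξ ∈ special S).card = 112 := by
  have hq : Fintype.card (Dual (ZMod 3) V) = 3 * 243 := by rw [card_dual hd]; norm_num
  have e := sum_ne_zero hq hS (-4192) 1 0
  have h : ∀ η ∈ Finset.univ.filter fun η : Dual (ZMod 3) V => η ≠ 0, (-4192 + 1 * (sq3 (lv S η 0)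
      (lv S η 1) (lv S η 2) : ℤ) + 0 * (cub3 (lv S η 0) (lv S η 1) (lv S η 2) : ℤ)) =
      342 * if code S η = 4534 then 1 else 0 := by
    intro η hη
    change (-4192 + 1 * (code S η : ℤ) + 0 * (_ : ℤ)) = _
    rcases code_mem hd hS hn (Finset.mem_filter.1 hη).2 with h | h <;> simp [h]
  rw [Finset.sum_congr rfl h, ← Finset.mul_sum, ← Nat.cast_one, ← Nat.cast_zero] at e
  rw [hn] at e
  norm_num [Finset.filter_filter] at e
  have h' : (Finset.univ.filter fun ξ => ξ ∈ special S) =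
      Finset.univ.filter fun ξ => ¬ξ = 0 ∧ code S ξ = 4534 := by
    ext ξ
    rw [Finset.mem_filter, Finset.mem_filter]
    rfl
  rw [h']
  omega

end

/-- The size of the section at `u` in a direction whose exceptional section is at `v`. -/
def sectionSize (b : Bool) (v u : ZMod 3) : ℕ :=
  Bool.rec (if u = v then 40 else 36) (if u = v then 22 else 45) b

section
variable {V : Type} [AddCommGroup V] [Module (ZMod 3) V]

theorem lv_eq_ite_of_sections {S : Finset V} {ζ : Dual (ZMod 3) V} {t : ZMod 3} {x y : ℕ}
    (h0 : lv S ζ t = x) (h1 : lv S ζ (t + 1) = y) (h2 : lv S ζ (t + 2) = y) (u : ZMod 3) :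
    lv S ζ u = if u = t then x else y := by
  obtain h | h | h := zmod3_cases (u - t)
  · rw [if_pos (sub_eq_zero.1 h), sub_eq_zero.1 h, h0]
  · rw [sub_eq_iff_eq_add'.1 h, h1, if_neg (by simp)]
  · rw [sub_eq_iff_eq_add'.1 h, h2, if_neg (by rw [add_eq_left]; decide)]

theorem lv_eq_ite_of_neg {S : Finset V} {ξ ζ : Dual (ZMod 3) V} (hζ : ζ = ξ ∨ ζ = -ξ) {x y : ℕ}
    (h : ∃ v, ∀ u, lv S ζ u = if u = v then x else y) :
    ∃ v, ∀ u, lv S ξ u = if u = v then x else y := by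
  rcases hζ with rfl | rfl
  · exact h
  · obtain ⟨v, hv⟩ := h
    refine ⟨-v, fun u => ?_⟩
    have := hv (-u)
    rw [lv_neg, neg_neg] at this
    rw [this]
    simp only [neg_eq_iff_eq_neg]

open Classical in
theorem exists_lv_eq_sectionSize [Finite V] (hd : finrank (ZMod 3) V = 6) {S : Finset V}
    (hS : CapSet S) (hn : S.card = 112) {ξ : Dual (ZMod 3) V} (hξ : ξ ≠ 0) :
    ∃ v, ∀ u, lv S ξ u = sectionSize (decide (ξ ∈ special S)) v u := by
  have hM : ∀ ζ : Dual (ZMod 3) V, ζ ≠ 0 → ∀ t, lv S ζ t ≤ 45 :=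
    fun _ h t => lv_le_of_bound capBound_five hd hS h t
  rcases code_mem hd hS hn hξ with hX | hX
  · obtain ⟨ζ, -, hζ, t, ha, hb, hc⟩ := exists_sections_of_code (a := 45) (b := 45) (c := 22)
      hn hM hξ hX (by decide +kernel)
    rw [decide_eq_true ⟨hξ, hX⟩]
    refine lv_eq_ite_of_neg hζ ⟨t + 2, lv_eq_ite_of_sections hc ?_ ?_⟩
    · rwa [add_assoc, show (2 + 1 : ZMod 3) = 0 from rfl, add_zero]
    · rwa [add_assoc, show (2 + 2 : ZMod 3) = 1 from rfl]
  · obtain ⟨ζ, -, hζ, t, ha, hb, hc⟩ := exists_sections_of_code (a := 40) (b := 36) (c := 36)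
      hn hM hξ hX (by decide +kernel)
    rw [decide_eq_false fun h => by have := h.2; omega]
    exact lv_eq_ite_of_neg hζ ⟨t, lv_eq_ite_of_sections ha hb hc⟩

/-- Inclusion-exclusion over the four parallel classes of lines in an affine plane. -/
theorem card_cell (S : Finset V) (ξ η : Dual (ZMod 3) V) (a b : ZMod 3) :
    3 * (S.filter fun x => ξ x = a ∧ η x = b).card + S.card =
      lv S ξ a + lv S η b + lv S (ξ + η) (a + b) + lv S (ξ - η) (a - b) := by
  have key : ∀ u v a b : ZMod 3, 3 * (if u = a ∧ v = b then 1 else 0) + 1 =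
      (if u = a then 1 else 0) + (if v = b then 1 else 0) + (if u + v = a + b then 1 else 0) +
        if u - v = a - b then 1 else 0 := by decide
  simp only [lv_sum, Finset.card_filter, Finset.card_eq_sum_ones S, Finset.mul_sum,
    ← Finset.sum_add_distrib]
  exact Finset.sum_congr rfl fun x _ => key (ξ x) (η x) a b

end

/-- Three times the size of a cell plus `112`, when the four directions of a pencil have the
indicated types. -/
def cellSum (b₁ b₂ b₃ b₄ : Bool) (v₁ v₂ v₃ v₄ : ZMod 3) (p : ZMod 3 × ZMod 3) : ℕ :=
  sectionSize b₁ v₁ p.1 + sectionSize b₂ v₂ p.2 + sectionSize b₃ v₃ (p.1 + p.2) +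
    sectionSize b₄ v₄ (p.1 - p.2)

theorem cellSum_cases : ∀ b₁ b₂ b₃ b₄ : Bool, ∀ v₁ v₂ v₃ v₄ : ZMod 3,
    (∀ p, 112 ≤ cellSum b₁ b₂ b₃ b₄ v₁ v₂ v₃ v₄ p ∧
      (cellSum b₁ b₂ b₃ b₄ v₁ v₂ v₃ v₄ p - 112) % 3 = 0) →
    ((Finset.univ : Finset (ZMod 3 × ZMod 3)).val.map
        (fun p => (cellSum b₁ b₂ b₃ b₄ v₁ v₂ v₃ v₄ p - 112) / 3) =
          {18, 18, 18, 18, 9, 9, 9, 9, 4} ∧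
      b₁.toNat + b₂.toNat + b₃.toNat + b₄.toNat = 2) ∨
    ((Finset.univ : Finset (ZMod 3 × ZMod 3)).val.map
        (fun p => (cellSum b₁ b₂ b₃ b₄ v₁ v₂ v₃ v₄ p - 112) / 3) =
          {15, 15, 15, 15, 15, 15, 10, 6, 6} ∧
      b₁.toNat + b₂.toNat + b₃.toNat + b₄.toNat = 1) ∨
    ((Finset.univ : Finset (ZMod 3 × ZMod 3)).val.map
        (fun p => (cellSum b₁ b₂ b₃ b₄ v₁ v₂ v₃ v₄ p - 112) / 3) =
          {16, 12, 12, 12, 12, 12, 12, 12, 12} ∧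
      b₁.toNat + b₂.toNat + b₃.toNat + b₄.toNat = 0) := by
  decide +kernel

section
variable {V : Type} [AddCommGroup V] [Module (ZMod 3) V] [Finite V]

/-- The sizes of the nine parts of `S` cut out by two functionals. -/
def cells (S : Finset V) (ξ η : Dual (ZMod 3) V) : Multiset ℕ :=
  (Finset.univ : Finset (ZMod 3 × ZMod 3)).val.map
    fun p => (S.filter fun x => ξ x = p.1 ∧ η x = p.2).card

open Classical in
/-- The number of special lines in a plane of functionals. -/
noncomputable def specialLines (S : Finset V) (ξ η : Dual (ZMod 3) V) : ℕ :=
  (decide (ξ ∈ special S)).toNat + (decide (η ∈ special S)).toNat +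
    (decide (ξ + η ∈ special S)).toNat + (decide (ξ - η ∈ special S)).toNat

open Classical in
theorem cells_cases (hd : finrank (ZMod 3) V = 6) {S : Finset V} (hS : CapSet S)
    (hn : S.card = 112) {ξ η : Dual (ZMod 3) V} (hξ : ξ ≠ 0) (hη : Indep ξ η) :
    (cells S ξ η = {18, 18, 18, 18, 9, 9, 9, 9, 4} ∧ specialLines S ξ η = 2) ∨
    (cells S ξ η = {15, 15, 15, 15, 15, 15, 10, 6, 6} ∧ specialLines S ξ η = 1) ∨
    (cells S ξ η = {16, 12, 12, 12, 12, 12, 12, 12, 12} ∧ specialLines S ξ η = 0) := by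
  have h3 : ξ + η ≠ 0 := fun h => hη (-1) <| LinearMap.ext fun x => by
    have := LinearMap.congr_fun h x
    simp only [LinearMap.add_apply, LinearMap.zero_apply, LinearMap.smul_apply,
      smul_eq_mul] at this ⊢
    linear_combination this
  have h4 : ξ - η ≠ 0 := fun h => hη 1 (by rw [one_smul, sub_eq_zero.1 h])
  obtain ⟨v₁, e₁⟩ := exists_lv_eq_sectionSize hd hS hn hξ
  obtain ⟨v₂, e₂⟩ := exists_lv_eq_sectionSize hd hS hn hη.ne_zero
  obtain ⟨v₃, e₃⟩ := exists_lv_eq_sectionSize hd hS hn h3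
  obtain ⟨v₄, e₄⟩ := exists_lv_eq_sectionSize hd hS hn h4
  have e : ∀ p : ZMod 3 × ZMod 3, 3 * (S.filter fun x => ξ x = p.1 ∧ η x = p.2).card + 112 =
      cellSum (decide (ξ ∈ special S)) (decide (η ∈ special S)) (decide (ξ + η ∈ special S))
        (decide (ξ - η ∈ special S)) v₁ v₂ v₃ v₄ p := by
    intro p
    rw [← hn, card_cell, e₁, e₂, e₃, e₄]
    rfl
  have h := cellSum_cases _ _ _ _ v₁ v₂ v₃ v₄ fun p => by
    rw [← e p]
    omega
  simp only [← e, Nat.add_sub_cancel, Nat.mul_div_cancel_left _ (Nat.succ_pos 2)] at h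
  exact h

end

section
variable {E : Type} [AddCommGroup E] [Module (ZMod 3) E]

theorem linearIndependent_pair_iff {x : E} (hx : x ≠ 0) {y : E} :
    LinearIndependent (ZMod 3) ![x, y] ↔ ¬ (y = 0 ∨ y = x ∨ y = -x) := by
  rw [LinearIndependent.pair_iff' hx]
  constructor
  · rintro h (rfl | rfl | rfl)
    · exact h 0 (zero_smul _ _)
    · exact h 1 (one_smul _ _)
    · exact h (-1) (by rw [neg_smul, one_smul])
  · rintro h a rfl
    obtain rfl | rfl | rfl := zmod3_cases a
    · exact h (Or.inl (zero_smul _ _))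
    · exact h (Or.inr (Or.inl (one_smul _ _)))
    · exact h (Or.inr (Or.inr (by rw [show (2 : ZMod 3) = -1 from rfl, neg_smul, one_smul])))

theorem ne_neg_self {x : E} (hx : x ≠ 0) : x ≠ -x := fun h => by
  have h2 : (2 : ZMod 3) • x = 0 := by rw [two_smul]; exact eq_neg_iff_add_eq_zero.1 h
  exact (smul_eq_zero.1 h2).elim (by decide) hx

theorem span_pair_eq_iff {W : Submodule (ZMod 3) E} (hW : finrank (ZMod 3) W = 2) {x y : E}
    (h : LinearIndependent (ZMod 3) ![x, y]) :
    Submodule.span (ZMod 3) {x, y} = W ↔ x ∈ W ∧ y ∈ W := by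
  constructor
  · rintro rfl
    exact ⟨Submodule.subset_span (by simp), Submodule.subset_span (by simp)⟩
  · rintro ⟨hx, hy⟩
    have : FiniteDimensional (ZMod 3) W := FiniteDimensional.of_finrank_pos (by omega)
    refine Submodule.eq_of_le_of_finrank_eq (Submodule.span_le.2 (Set.pair_subset hx hy)) ?_
    have := finrank_span_eq_card h
    rw [Matrix.range_cons_cons_empty] at this
    rw [this, hW, Fintype.card_fin]

theorem finrank_span_pair {x y : E} (h : LinearIndependent (ZMod 3) ![x, y]) :
    finrank (ZMod 3) (Submodule.span (ZMod 3) {x, y}) = 2 := by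
  have := finrank_span_eq_card h
  rwa [Matrix.range_cons_cons_empty, Fintype.card_fin] at this

theorem exists_span_pair_eq {W : Submodule (ZMod 3) E} (hW : finrank (ZMod 3) W = 2) :
    ∃ x y, LinearIndependent (ZMod 3) ![x, y] ∧ W = Submodule.span (ZMod 3) {x, y} := by
  have : FiniteDimensional (ZMod 3) W := FiniteDimensional.of_finrank_pos (by omega)
  have b := finBasisOfFinrankEq (ZMod 3) W hW
  have h := b.linearIndependent.map' W.subtype W.ker_subtype
  have e : W.subtype ∘ b = ![(b 0 : E), b 1] := by ext i; fin_cases i <;> rfl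
  rw [e] at h
  exact ⟨_, _, h, ((span_pair_eq_iff hW h).2 ⟨(b 0).2, (b 1).2⟩).symm⟩

open Classical in
/-- The linearly independent pairs of `A ×ˢ B`. -/
noncomputable def indepPairs (A B : Finset E) : Finset (E × E) :=
  (A ×ˢ B).filter fun p => LinearIndependent (ZMod 3) ![p.1, p.2]

open Classical in
theorem card_indepPairs {A B : Finset E} {c : ℕ} (hA : 0 ∉ A)
    (h : ∀ x ∈ A, (B ∩ {0, x, -x}).card = c) :
    (indepPairs A B).card = A.card * (B.card - c) := by
  rw [indepPairs, Finset.card_filter, Finset.sum_product, Finset.card_eq_sum_ones A,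
    Finset.sum_mul]
  refine Finset.sum_congr rfl fun x hx => ?_
  rw [← Finset.card_filter, one_mul, ← h x hx, Finset.inter_comm, ← Finset.card_sdiff]
  congr 1
  ext y
  simp [linearIndependent_pair_iff (ne_of_mem_of_not_mem hx hA)]

open Classical in
theorem card_inter_triple {B : Finset E} (h0 : 0 ∈ B) {x : E} (hx : x ≠ 0) (h1 : x ∈ B)
    (h2 : -x ∈ B) : (B ∩ {0, x, -x}).card = 3 := by
  rw [Finset.inter_eq_right.2 (by simp [Finset.insert_subset_iff, h0, h1, h2]),
    Finset.card_eq_three]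
  exact ⟨0, x, -x, hx.symm, (neg_ne_zero.2 hx).symm, ne_neg_self hx, rfl⟩

open Classical in
theorem card_inter_triple_of_zero_notMem {B : Finset E} (h0 : 0 ∉ B) {x : E} (hx : x ≠ 0)
    (h1 : x ∈ B) (h2 : -x ∈ B) : (B ∩ {0, x, -x}).card = 2 := by
  rw [Finset.inter_insert_of_notMem h0,
    Finset.inter_eq_right.2 (by simp [Finset.insert_subset_iff, h1, h2]),
    Finset.card_pair (ne_neg_self hx)]

variable [Fintype E]

open Classical in
/-- The two-dimensional subspaces. -/
noncomputable def planes (E : Type) [AddCommGroup E] [Module (ZMod 3) E] [Fintype E] :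
    Finset (Submodule (ZMod 3) E) :=
  (Set.toFinite {W : Submodule (ZMod 3) E | finrank (ZMod 3) W = 2}).toFinset

theorem mem_planes {W : Submodule (ZMod 3) E} : W ∈ planes E ↔ finrank (ZMod 3) W = 2 := by
  simp [planes]

open Classical in
theorem card_indepPairs_eq_sum (A B : Finset E) :
    (indepPairs A B).card =
      ∑ W ∈ planes E, (indepPairs (A.filter (· ∈ W)) (B.filter (· ∈ W))).card := by
  rw [Finset.card_eq_sum_card_fiberwise (f := fun p => Submodule.span (ZMod 3) {p.1, p.2})
    (t := planes E)]
  · refine Finset.sum_congr rfl fun W hW => congrArg Finset.card ?_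
    ext p
    simp only [indepPairs, Finset.mem_filter, Finset.mem_product]
    constructor
    · rintro ⟨⟨⟨h1, h2⟩, h3⟩, h4⟩
      rw [span_pair_eq_iff (mem_planes.1 hW) h3] at h4
      exact ⟨⟨⟨h1, h4.1⟩, h2, h4.2⟩, h3⟩
    · rintro ⟨⟨⟨h1, h4⟩, h2, h5⟩, h3⟩
      exact ⟨⟨⟨h1, h2⟩, h3⟩, (span_pair_eq_iff (mem_planes.1 hW) h3).2 ⟨h4, h5⟩⟩
  · intro p hp
    exact mem_planes.2 (finrank_span_pair (Finset.mem_filter.1 hp).2)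

open Classical in
theorem card_filter_mem_plane {W : Submodule (ZMod 3) E} (hW : W ∈ planes E) :
    (Finset.univ.filter (· ∈ W)).card = 9 := by
  have h := natCard_eq_pow_finrank (K := ZMod 3) (V := W)
  rw [mem_planes.1 hW, Nat.card_zmod] at h
  rw [← Fintype.card_subtype, ← Nat.card_eq_fintype_card, h]
  norm_num

open Classical in
/-- Counting independent pairs meeting a symmetric set `T`, plane by plane. -/
theorem pair_counts {T : Finset E} (h0 : 0 ∉ T) (hT : ∀ x ∈ T, -x ∈ T) :
    (Fintype.card E - 1) * (Fintype.card E - 3) = 48 * (planes E).card ∧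
    T.card * (Fintype.card E - 3) = ∑ W ∈ planes E, 6 * (T.filter (· ∈ W)).card ∧
    T.card * (T.card - 2) =
      ∑ W ∈ planes E, (T.filter (· ∈ W)).card * ((T.filter (· ∈ W)).card - 2) := by
  have hne : ∀ x ∈ T, x ≠ 0 := fun x hx => ne_of_mem_of_not_mem hx h0
  refine ⟨?_, ?_, ?_⟩
  · have h := card_indepPairs_eq_sum (Finset.univ.erase (0 : E)) Finset.univ
    rw [card_indepPairs (c := 3) (by simp) fun x hx => card_inter_triple (by simp)
      (Finset.ne_of_mem_erase hx) (by simp) (by simp), Finset.card_erase_of_mem (by simp),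
      Finset.card_univ] at h
    rw [h, mul_comm, ← smul_eq_mul, ← Finset.sum_const]
    refine Finset.sum_congr rfl fun W hW => ?_
    rw [card_indepPairs (c := 3) (by simp), Finset.filter_erase,
      Finset.card_erase_of_mem (by simp), card_filter_mem_plane hW]
    intro x hx
    simp only [Finset.mem_filter, Finset.mem_erase] at hx
    exact card_inter_triple (by simp) hx.1.1 (by simp [hx.2]) (by simp [hx.2])
  · have h := card_indepPairs_eq_sum T Finset.univ
    rw [card_indepPairs (c := 3) h0 fun x hx => card_inter_triple (by simp) (hne x hx) (by simp)
      (by simp), Finset.card_univ] at h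
    rw [h]
    refine Finset.sum_congr rfl fun W hW => ?_
    rw [card_indepPairs (c := 3) (by simp [h0]), card_filter_mem_plane hW, mul_comm]
    intro x hx
    rw [Finset.mem_filter] at hx
    exact card_inter_triple (by simp) (hne x hx.1) (by simp [hx.2]) (by simp [hx.2])
  · have h := card_indepPairs_eq_sum T T
    rw [card_indepPairs (c := 2) h0 fun x hx => card_inter_triple_of_zero_notMem h0 (hne x hx) hx
      (hT x hx)] at h
    rw [h]
    refine Finset.sum_congr rfl fun W hW => card_indepPairs (by simp [h0]) fun x hx => ?_
    rw [Finset.mem_filter] at hx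
    exact card_inter_triple_of_zero_notMem (by simp [h0]) (hne x hx.1) (by simp [hx])
      (by simp [hT x hx.1, hx.2])

end

/-- Recovering the distribution of a `{0, 2, 4}`-valued function from two of its moments. -/
theorem card_fibers_of_moments {α : Type} {P : Finset α} {k : α → ℕ}
    (hk : ∀ W ∈ P, k W = 4 ∨ k W = 2 ∨ k W = 0) {m₁ m₂ : ℕ} (h1 : 2 * m₁ = ∑ W ∈ P, k W)
    (h2 : 8 * m₂ = ∑ W ∈ P, k W * (k W - 2)) :
    (P.filter fun W => k W = 4).card = m₂ ∧ (P.filter fun W => k W = 2).card + 2 * m₂ = m₁ ∧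
      (P.filter fun W => k W = 0).card + m₁ = P.card + m₂ := by
  have e0 : P.card = (P.filter fun W => k W = 4).card + (P.filter fun W => k W = 2).card +
      (P.filter fun W => k W = 0).card := by
    simp only [Finset.card_filter, ← Finset.sum_add_distrib, Finset.card_eq_sum_ones P]
    exact Finset.sum_congr rfl fun W hW => by obtain h | h | h := hk W hW <;> simp [h]
  have e1 : ∑ W ∈ P, k W = 4 * (P.filter fun W => k W = 4).card +
      2 * (P.filter fun W => k W = 2).card := by
    simp only [Finset.card_filter, Finset.mul_sum, ← Finset.sum_add_distrib]
    exact Finset.sum_congr rfl fun W hW => by obtain h | h | h := hk W hW <;> simp [h]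
  have e2 : ∑ W ∈ P, k W * (k W - 2) = 8 * (P.filter fun W => k W = 4).card := by
    simp only [Finset.card_filter, Finset.mul_sum]
    exact Finset.sum_congr rfl fun W hW => by obtain h | h | h := hk W hW <;> simp [h]
  omega

section
variable {E : Type} [AddCommGroup E] [Module (ZMod 3) E]

open Classical in
theorem card_filter_mem_span_pair {T : Finset E} (h0 : 0 ∉ T) (hT : ∀ x, -x ∈ T ↔ x ∈ T) {x y : E}
    (h : LinearIndependent (ZMod 3) ![x, y]) :
    (T.filter (· ∈ Submodule.span (ZMod 3) {x, y})).card =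
      2 * ((decide (x ∈ T)).toNat + (decide (y ∈ T)).toNat + (decide (x + y ∈ T)).toNat +
        (decide (x - y ∈ T)).toNat) := by
  have e : T.filter (· ∈ Submodule.span (ZMod 3) {x, y}) =
      (Finset.univ.filter fun p : ZMod 3 × ZMod 3 => p.1 • x + p.2 • y ∈ T).image
        fun p => p.1 • x + p.2 • y := by
    ext z
    simp only [Finset.mem_filter, Finset.mem_image, Finset.mem_univ, true_and,
      Submodule.mem_span_pair, Prod.exists]
    constructor
    · rintro ⟨hz, a, b, rfl⟩
      exact ⟨a, b, hz, rfl⟩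
    · rintro ⟨a, b, hz, rfl⟩
      exact ⟨hz, a, b, rfl⟩
  have inj : Function.Injective fun p : ZMod 3 × ZMod 3 => p.1 • x + p.2 • y := by
    rintro ⟨a, b⟩ ⟨c, d⟩ hp
    have := LinearIndependent.pair_iff.1 h (a - c) (b - d) (by
      rw [sub_smul, sub_smul, sub_add_sub_comm]; exact sub_eq_zero.2 hp)
    exact Prod.ext (sub_eq_zero.1 this.1) (sub_eq_zero.1 this.2)
  have toNat_decide : ∀ (p : Prop) [Decidable p], (decide p).toNat = if p then 1 else 0 :=
      fun p _ => by
        by_cases hp : p <;> simp [hp]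
  have sum3 : ∀ f : ZMod 3 → ℕ, ∑ a, f a = f 0 + f 1 + f (-1) := fun f => Fin.sum_univ_three f
  have c0 : x + -y ∈ T ↔ x - y ∈ T := by rw [sub_eq_add_neg]
  have c1 : -x + -y ∈ T ↔ x + y ∈ T := by rw [← neg_add, hT]
  have c2 : -x + y ∈ T ↔ x - y ∈ T := by rw [← hT (x - y), neg_sub, sub_eq_neg_add]
  rw [e, Finset.card_image_of_injective _ inj, Finset.card_filter, Fintype.sum_prod_type, sum3,
    sum3, sum3, sum3]
  simp only [zero_smul, one_smul, neg_smul, zero_add, add_zero, h0, if_false, hT, c0, c1, c2,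
    toNat_decide]
  ring

end

section
variable {V : Type} [AddCommGroup V] [Module (ZMod 3) V]

theorem neg_mem_special {S : Finset V} {ξ : Dual (ZMod 3) V} :
    -ξ ∈ special S ↔ ξ ∈ special S := by
  simp only [special, Set.mem_ofPred_eq, neg_ne_zero, code_neg]

theorem zero_notMem_special {S : Finset V} : (0 : Dual (ZMod 3) V) ∉ special S :=
  fun h => h.1 rfl

end

section
variable {V : Type} [AddCommGroup V] [Module (ZMod 3) V] [Fintype (Dual (ZMod 3) V)]

open Classical in
/-- The number of special functionals in a subspace of the dual space. -/
noncomputable def specialCount (S : Finset V) (W : Submodule (ZMod 3) (Dual (ZMod 3) V)) : ℕ :=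
  ((Finset.univ.filter fun ξ => ξ ∈ special S).filter (· ∈ W)).card

theorem specialCount_span_pair {S : Finset V} {ξ η : Dual (ZMod 3) V}
    (h : LinearIndependent (ZMod 3) ![ξ, η]) :
    specialCount S (Submodule.span (ZMod 3) {ξ, η}) = 2 * specialLines S ξ η := by
  classical
  rw [specialCount, card_filter_mem_span_pair (by simp [zero_notMem_special])
    (fun ξ => by simp [neg_mem_special]) h, specialLines]
  simp only [Finset.mem_filter, Finset.mem_univ, true_and]

theorem cells_specialCount [Finite V] (hd : finrank (ZMod 3) V = 6) {S : Finset V} (hS : CapSet S)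
    (hn : S.card = 112) {ξ η : Dual (ZMod 3) V} (h : LinearIndependent (ZMod 3) ![ξ, η]) :
    (cells S ξ η = {18, 18, 18, 18, 9, 9, 9, 9, 4} ∧
      specialCount S (Submodule.span (ZMod 3) {ξ, η}) = 4) ∨
    (cells S ξ η = {15, 15, 15, 15, 15, 15, 10, 6, 6} ∧
      specialCount S (Submodule.span (ZMod 3) {ξ, η}) = 2) ∨
    (cells S ξ η = {16, 12, 12, 12, 12, 12, 12, 12, 12} ∧
      specialCount S (Submodule.span (ZMod 3) {ξ, η}) = 0) := by
  have hξ : ξ ≠ 0 := h.ne_zero 0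
  have hη : Indep ξ η := fun β hβ => (LinearIndependent.pair_iff' hξ).1 h β hβ.symm
  rw [specialCount_span_pair h]
  obtain ⟨h1, h2⟩ | ⟨h1, h2⟩ | ⟨h1, h2⟩ := cells_cases hd hS hn hξ hη <;> simp [h1, h2]

theorem card_planes_of_cells {S : Finset V} {m : Multiset ℕ} {c : ℕ}
    (h : ∀ ξ η : Dual (ZMod 3) V, LinearIndependent (ZMod 3) ![ξ, η] →
      (cells S ξ η = m ↔ specialCount S (Submodule.span (ZMod 3) {ξ, η}) = c)) :
    Nat.card {W : Submodule (ZMod 3) (Dual (ZMod 3) V) //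
      ∃ ξ η : Dual (ZMod 3) V, LinearIndependent (ZMod 3) ![ξ, η] ∧
        W = Submodule.span (ZMod 3) {ξ, η} ∧ cells S ξ η = m} =
      ((planes (Dual (ZMod 3) V)).filter fun W => specialCount S W = c).card := by
  refine Nat.subtype_card _ fun W => ?_
  rw [Finset.mem_filter, mem_planes]
  constructor
  · rintro ⟨hW, hc⟩
    obtain ⟨ξ, η, hi, rfl⟩ := exists_span_pair_eq hW
    exact ⟨ξ, η, hi, rfl, (h ξ η hi).2 hc⟩
  · rintro ⟨ξ, η, hi, rfl, hm⟩
    exact ⟨finrank_span_pair hi, (h ξ η hi).1 hm⟩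

theorem card_planes_specialCount [Finite V] (hd : finrank (ZMod 3) V = 6) {S : Finset V}
    (hS : CapSet S) (hn : S.card = 112) :
    (planes (Dual (ZMod 3) V)).card = 11011 ∧
    ((planes (Dual (ZMod 3) V)).filter fun W => specialCount S W = 4).card = 1540 ∧
    ((planes (Dual (ZMod 3) V)).filter fun W => specialCount S W = 2).card = 3696 ∧
    ((planes (Dual (ZMod 3) V)).filter fun W => specialCount S W = 0).card = 5775 := by
  classical
  have hk : ∀ W ∈ planes (Dual (ZMod 3) V),
      specialCount S W = 4 ∨ specialCount S W = 2 ∨ specialCount S W = 0 := fun W hW => by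
    obtain ⟨ξ, η, hi, rfl⟩ := exists_span_pair_eq (mem_planes.1 hW)
    exact (cells_specialCount hd hS hn hi).imp And.right (Or.imp And.right And.right)
  obtain ⟨e1, e2, e3⟩ := pair_counts (T := Finset.univ.filter fun ξ => ξ ∈ special S)
    (by simp [zero_notMem_special]) fun ξ => by simp [neg_mem_special]
  rw [card_special hd hS hn] at e2 e3
  rw [card_dual hd] at e1 e2
  rw [← Finset.mul_sum] at e2
  have := card_fibers_of_moments hk (m₁ := 6776) (m₂ := 1540)
    (by unfold specialCount; omega) (by unfold specialCount; omega)
  omega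

end

theorem capSet_of_forall_ne {V : Type} [AddCommGroup V] [Module (ZMod 3) V] {S : Finset V}
    (h : ∀ a ∈ S, ∀ b ∈ S, ∀ c ∈ S, a ≠ b → a ≠ c → b ≠ c → a + b + c ≠ 0) : CapSet S := by
  intro a ha b hb c hc habc
  by_contra hab
  refine h a ha b hb c hc hab ?_ ?_ habc
  · rintro rfl
    rw [← add_self_add_self a, add_left_inj, add_right_inj] at habc
    exact hab habc.symm
  · rintro rfl
    rw [← add_self_add_self b, add_left_inj, add_left_inj] at habc
    exact hab habc

end TernaryCap

/-- 4-flat directions of the 112-cap 6-flat: each gives one of three nine-slice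
multisets, and the numbers of two-dimensional subspaces of the dual space (4-flat
directions) in the three cases are 1540, 3696, and 5775, out of 11011 in total. -/
theorem cap112_four_flat_directions (S : Finset (Fin 6 → ZMod 3)) (hS : IsCap S)
    (hcard : S.card = 112) :
    (∀ ℓ₁ ℓ₂ : (Fin 6 → ZMod 3) →ₗ[ZMod 3] ZMod 3,
      LinearIndependent (ZMod 3) ![ℓ₁, ℓ₂] →
        nineMul S ℓ₁ ℓ₂ = {18, 18, 18, 18, 9, 9, 9, 9, 4} ∨
        nineMul S ℓ₁ ℓ₂ = {15, 15, 15, 15, 15, 15, 10, 6, 6} ∨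
        nineMul S ℓ₁ ℓ₂ = {16, 12, 12, 12, 12, 12, 12, 12, 12}) ∧
    Nat.card {W : Submodule (ZMod 3) (Module.Dual (ZMod 3) (Fin 6 → ZMod 3)) //
      Module.finrank (ZMod 3) W = 2} = 11011 ∧
    Nat.card {W : Submodule (ZMod 3) (Module.Dual (ZMod 3) (Fin 6 → ZMod 3)) //
      ∃ ℓ₁ ℓ₂ : Module.Dual (ZMod 3) (Fin 6 → ZMod 3),
        LinearIndependent (ZMod 3) ![ℓ₁, ℓ₂] ∧ W = Submodule.span (ZMod 3) {ℓ₁, ℓ₂} ∧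
        nineMul S ℓ₁ ℓ₂ = {18, 18, 18, 18, 9, 9, 9, 9, 4}} = 1540 ∧
    Nat.card {W : Submodule (ZMod 3) (Module.Dual (ZMod 3) (Fin 6 → ZMod 3)) //
      ∃ ℓ₁ ℓ₂ : Module.Dual (ZMod 3) (Fin 6 → ZMod 3),
        LinearIndependent (ZMod 3) ![ℓ₁, ℓ₂] ∧ W = Submodule.span (ZMod 3) {ℓ₁, ℓ₂} ∧
        nineMul S ℓ₁ ℓ₂ = {15, 15, 15, 15, 15, 15, 10, 6, 6}} = 3696 ∧
    Nat.card {W : Submodule (ZMod 3) (Module.Dual (ZMod 3) (Fin 6 → ZMod 3)) //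
      ∃ ℓ₁ ℓ₂ : Module.Dual (ZMod 3) (Fin 6 → ZMod 3),
        LinearIndependent (ZMod 3) ![ℓ₁, ℓ₂] ∧ W = Submodule.span (ZMod 3) {ℓ₁, ℓ₂} ∧
        nineMul S ℓ₁ ℓ₂ = {16, 12, 12, 12, 12, 12, 12, 12, 12}} = 5775 := by
  have : Finite (Module.Dual (ZMod 3) (Fin 6 → ZMod 3)) := Module.finite_of_finite (ZMod 3)
  let : Fintype (Module.Dual (ZMod 3) (Fin 6 → ZMod 3)) := Fintype.ofFinite _
  have hd : Module.finrank (ZMod 3) (Fin 6 → ZMod 3) = 6 := by simp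
  have hC := TernaryCap.capSet_of_forall_ne hS
  have key := fun ξ η h => TernaryCap.cells_specialCount hd hC hcard (ξ := ξ) (η := η) h
  obtain ⟨h, h4, h2, h0⟩ := TernaryCap.card_planes_specialCount hd hC hcard
  refine ⟨fun ξ η hi => (key ξ η hi).imp And.left (Or.imp And.left And.left), ?_, ?_, ?_, ?_⟩
  · rw [← h]
    exact Nat.subtype_card _ fun W => TernaryCap.mem_planes
  · rw [← h4]
    refine TernaryCap.card_planes_of_cells fun ξ η hi => ?_
    obtain ⟨e, k⟩ | ⟨e, k⟩ | ⟨e, k⟩ := key ξ η hi <;> rw [e, k] <;> decide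
  · rw [← h2]
    refine TernaryCap.card_planes_of_cells fun ξ η hi => ?_
    obtain ⟨e, k⟩ | ⟨e, k⟩ | ⟨e, k⟩ := key ξ η hi <;> rw [e, k] <;> decide
  · rw [← h0]
    refine TernaryCap.card_planes_of_cells fun ξ η hi => ?_
    obtain ⟨e, k⟩ | ⟨e, k⟩ | ⟨e, k⟩ := key ξ η hi <;> rw [e, k] <;> decide
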